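/- arXiv:1411.0915 — 2 statements merged into one kernel-verified Lean document; each statement's English description precedes it below -/
import Mathlib

section
/- Let d ≥ 2, let ν be a Borel probability measure on ℝ^d, let ρ satisfy d − 1 < ρ < d, and let 0 < r_0 < R_0 < ∞. Then for any cutoff radius r_1 with 0 < r_1 ≤ r_0/4 there exist a cutoff radius r_d > 0 and a constant C (depending on r_0, R_0, ρ, d, r_1) such that for all x ∈ ℝ^d and all r ∈ [r_0, R_0]: (ν_x * K^{(1)}_{ρ+1−d})(r) ≤ C · S(ν * K^{(d)}_ρ)(x, r), where K^{(1)}_{ρ+1−d}(t) = |t|^{−(ρ+1−d)} 1_{[−r_1,r_1]}(t) is the one-dimensional truncated kernel and K^{(d)}_ρ(x) = |x|^{−ρ} 1_{B(0,r_d)}(x) is the d-dimensional truncated kernel. -/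
open MeasureTheory Metric

/-- The truncated Riesz kernel `K_ρ(x) = |x|^{-ρ} 1_{B(0,r)}(x)` on `ℝ^d`. -/
noncomputable def rieszKernel {d : ℕ} (ρ r : ℝ) (x : EuclideanSpace ℝ (Fin d)) : ℝ :=
  if ‖x‖ < r then ‖x‖ ^ (-ρ) else 0

/-- The one-dimensional truncated Riesz kernel `K_ρ(t) = |t|^{-ρ} 1_{[-r,r]}(t)`. -/
noncomputable def rieszKernel1 (ρ r : ℝ) (t : ℝ) : ℝ :=
  if |t| ≤ r then |t| ^ (-ρ) else 0

open Module

section Sphere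

variable {E : Type*} [NormedAddCommGroup E] [InnerProductSpace ℝ E] [MeasurableSpace E]
  [BorelSpace E] {n : ℕ} [Fact (finrank ℝ E = n + 1)]

/-- The unit sphere has σ-finite `n`-dimensional Hausdorff measure in an `(n+1)`-dimensional
space. -/
theorem sigmaFinite_hausdorffMeasure_restrict_sphere (hn : 0 < n) :
    SigmaFinite ((μH[(n : ℝ)] : Measure E).restrict (sphere 0 1)) := by
  have hfr : finrank ℝ E = n + 1 := Fact.out
  have : FiniteDimensional ℝ E := .of_finrank_pos (by omega)
  have : Nontrivial E := Module.nontrivial_of_finrank_pos (R := ℝ) (by omega)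
  obtain ⟨v, hv⟩ := exists_norm_eq E zero_le_one
  have hv0 : v ≠ 0 := by rintro rfl; simp at hv
  let U := (OrthonormalBasis.fromOrthogonalSpanSingleton (𝕜 := ℝ) n hv0).repr
  let f : EuclideanSpace ℝ (Fin n) → E := fun w => stereoInvFunAux v (U.symm w : E)
  have hf : ContDiff ℝ 1 f :=
    contDiff_stereoInvFunAux.comp ((ℝ ∙ v)ᗮ.subtypeL.contDiff.comp U.symm.contDiff)
  have hcover : sphere (0 : E) 1 ⊆ {v} ∪ Set.range f := by
    intro x hx
    by_cases hxv : x = v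
    · exact Or.inl hxv
    · refine Or.inr ⟨U (stereoToFun v x), ?_⟩
      simp only [f, LinearIsometryEquiv.symm_apply_apply]
      exact congrArg Subtype.val (stereo_left_inv hv (x := ⟨x, hx⟩) hxv)
  have : Measure.IsAddHaarMeasure (μH[(n : ℝ)] : Measure (EuclideanSpace ℝ (Fin n))) := by
    simpa using isAddHaarMeasure_hausdorffMeasure (E := EuclideanSpace ℝ (Fin n))
  have hball (k : ℕ) : μH[(n : ℝ)] (f '' closedBall 0 k) < ⊤ := by
    obtain ⟨K, hK⟩ := hf.contDiffOn.exists_lipschitzOnWith one_ne_zero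
      (convex_closedBall (0 : EuclideanSpace ℝ (Fin n)) k) (isCompact_closedBall _ _)
    refine (hK.hausdorffMeasure_image_le n.cast_nonneg).trans_lt ?_
    exact ENNReal.mul_lt_top (by finiteness) measure_closedBall_lt_top
  have : NullSingletonClass (μH[(n : ℝ)] : Measure E) := Measure.nullSingletonClass_hausdorff E (by exact_mod_cast hn)
  refine ⟨⟨⟨fun k => (sphere 0 1)ᶜ ∪ ({v} ∪ f '' closedBall 0 k), fun _ => trivial,
    fun k => ?_, ?_⟩⟩⟩
  · refine (measure_union_le _ _).trans_lt (ENNReal.add_lt_top.2 ⟨?_, ?_⟩)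
    · rw [Measure.restrict_apply isClosed_sphere.measurableSet.compl]
      simp
    · refine (Measure.restrict_le_self _).trans_lt ((measure_union_le _ _).trans_lt ?_)
      exact ENNReal.add_lt_top.2 ⟨by rw [measure_singleton]; exact ENNReal.zero_lt_top, hball k⟩
  · refine Set.eq_univ_of_forall fun x => ?_
    by_cases hx : x ∈ sphere (0 : E) 1
    · rcases hcover hx with h | ⟨w, rfl⟩
      · exact Set.mem_iUnion.2 ⟨0, Or.inr (Or.inl h)⟩
      · obtain ⟨k, hk⟩ := exists_nat_ge ‖w‖
        exact Set.mem_iUnion.2 ⟨k, Or.inr (Or.inr ⟨w, by simpa using hk, rfl⟩)⟩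
    · exact Set.mem_iUnion.2 ⟨0, Or.inl hx⟩

/-- A spherical cap of radius `δ ≤ 1` has `n`-dimensional Hausdorff measure at least that of a
Euclidean ball of radius `δ / 2` in dimension `n`. -/
theorem hausdorffMeasure_closedBall_le_cap {u : E} (hu : ‖u‖ = 1) {δ : ℝ} (hδ : δ ≤ 1) :
    μH[(n : ℝ)] (closedBall (0 : EuclideanSpace ℝ (Fin n)) (δ / 2)) ≤
      μH[(n : ℝ)] (closedBall u δ ∩ sphere 0 1) := by
  have hfr : finrank ℝ E = n + 1 := Fact.out
  have : FiniteDimensional ℝ E := .of_finrank_pos (by omega)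
  have hu0 : u ≠ 0 := by rintro rfl; simp at hu
  let U := (OrthonormalBasis.fromOrthogonalSpanSingleton (𝕜 := ℝ) n hu0).repr
  let P : E → EuclideanSpace ℝ (Fin n) := fun x => U ((ℝ ∙ u)ᗮ.orthogonalProjectionOnto x)
  have hP : LipschitzWith 1 P := by
    rw [← one_mul (1 : NNReal)]
    exact U.lipschitz.comp (ℝ ∙ u)ᗮ.lipschitzWith_orthogonalProjectionOnto
  have hsub : closedBall (0 : EuclideanSpace ℝ (Fin n)) (δ / 2) ⊆
      P '' (closedBall u δ ∩ sphere 0 1) := by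
    intro w hw
    have hw' : ‖w‖ ≤ δ / 2 := by simpa using hw
    have hw0 := norm_nonneg w
    have hw2 : ‖w‖ ^ 2 ≤ 1 := by nlinarith
    set c := √(1 - ‖w‖ ^ 2) with hc
    have hc0 : 0 ≤ c := Real.sqrt_nonneg _
    have hc2 : c ^ 2 = 1 - ‖w‖ ^ 2 := Real.sq_sqrt (by linarith)
    have horth : inner ℝ (U.symm w : E) u = 0 := by
      rw [real_inner_comm]
      exact Submodule.mem_orthogonal_singleton_iff_inner_right.mp (U.symm w).2
    have hnorm (a : ℝ) : ‖(U.symm w : E) + a • u‖ ^ 2 = ‖w‖ ^ 2 + a ^ 2 := by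
      rw [norm_add_sq_real, inner_smul_right, horth, norm_smul, hu, ← Submodule.coe_norm,
        U.symm.norm_map]
      simp
    refine ⟨(U.symm w : E) + c • u, ⟨?_, ?_⟩, ?_⟩
    · have h := hnorm (c - 1)
      rw [mem_closedBall, dist_eq_norm]
      have he : (U.symm w : E) + c • u - u = (U.symm w : E) + (c - 1) • u := by module
      rw [he]
      refine abs_le_of_sq_le_sq' (b := δ) ?_ (by linarith) |>.2
      nlinarith
    · have h := hnorm c
      rw [mem_sphere_zero_iff_norm]
      nlinarith [norm_nonneg ((U.symm w : E) + c • u)]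
    · simp [P, Submodule.orthogonalProjectionOnto_orthogonalComplement_singleton_eq_zero]
  calc _ ≤ μH[(n : ℝ)] (P '' (closedBall u δ ∩ sphere 0 1)) := measure_mono hsub
    _ ≤ _ := by simpa using hP.hausdorffMeasure_image_le n.cast_nonneg (closedBall u δ ∩ sphere 0 1)

end Sphere

theorem measurable_rieszKernel {d : ℕ} (ρ r : ℝ) :
    Measurable (rieszKernel ρ r : EuclideanSpace ℝ (Fin d) → ℝ) :=
  Measurable.ite (measurableSet_lt measurable_norm measurable_const)
    (measurable_norm.pow_const _) measurable_const

theorem measurable_rieszKernel1 (ρ r : ℝ) : Measurable (rieszKernel1 ρ r) :=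
  Measurable.ite (measurableSet_le measurable_abs measurable_const)
    (measurable_abs.pow_const _) measurable_const

/-- The one-dimensional kernel is dominated by the spherical average of the `n + 1`-dimensional
kernel. -/
theorem exists_rieszKernel1_le_sphericalAverage {n : ℕ} {ρ r0 R0 r1 : ℝ} (hρ : (n : ℝ) < ρ)
    (hr0 : 0 < r0) (hR0 : r0 < R0) (hr1' : r1 ≤ r0 / 4) :
    ∃ C > 0, ∀ v : EuclideanSpace ℝ (Fin (n + 1)), ∀ r ∈ Set.Icc r0 R0,
      ENNReal.ofReal (rieszKernel1 (ρ - n) r1 (r - ‖v‖)) ≤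
        ENNReal.ofReal C * ∫⁻ σ in sphere (0 : EuclideanSpace ℝ (Fin (n + 1))) 1,
          ENNReal.ofReal (rieszKernel ρ r0 (v - r • σ)) ∂(μH[(n : ℝ)]) := by
  have hR : 0 < R0 := hr0.trans hR0
  have : Fact (finrank ℝ (EuclideanSpace ℝ (Fin (n + 1))) = n + 1) := ⟨by simp⟩
  have : Measure.IsAddHaarMeasure (μH[(n : ℝ)] : Measure (EuclideanSpace ℝ (Fin n))) := by
    simpa using isAddHaarMeasure_hausdorffMeasure (E := EuclideanSpace ℝ (Fin n))
  set m := μH[(n : ℝ)] (ball (0 : EuclideanSpace ℝ (Fin n)) 1)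
  have hmtop : m ≠ ⊤ := measure_ball_lt_top.ne
  have hm0 : 0 < m.toReal := ENNReal.toReal_pos (measure_ball_pos _ _ one_pos).ne' hmtop
  set c : ℝ := 2 ^ (-ρ) * ((1 / (2 * R0)) ^ n * m.toReal) with hc
  have hc0 : 0 < c := by positivity
  refine ⟨c⁻¹, inv_pos.2 hc0, fun v r ⟨hr, hrR⟩ => ?_⟩
  set h := |r - ‖v‖| with hh
  by_cases hle : h ≤ r1
  swap
  · rw [rieszKernel1, if_neg hle]
    simp
  rcases (abs_nonneg (r - ‖v‖)).eq_or_lt with h0 | hpos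
  · rw [rieszKernel1, if_pos hle, ← h0, Real.zero_rpow (by linarith)]
    simp
  change 0 < h at hpos
  have hrpos : 0 < r := hr0.trans_le hr
  have hvpos : 0 < ‖v‖ := by
    have := (abs_le.1 hle).2
    linarith
  set u := ‖v‖⁻¹ • v with hu
  have hu1 : ‖u‖ = 1 := by rw [hu, norm_smul, norm_inv, norm_norm, inv_mul_cancel₀ hvpos.ne']
  have hvu : v = ‖v‖ • u := by rw [hu, smul_inv_smul₀ hvpos.ne']
  have hδ : h / R0 ≤ 1 := by rw [div_le_one hR]; linarith
  have hker : ∀ σ ∈ closedBall u (h / R0) ∩ sphere 0 1,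
      (2 * h) ^ (-ρ) ≤ rieszKernel ρ r0 (v - r • σ) := by
    rintro σ ⟨hσ, hσ1⟩
    have hσ1 : ‖σ‖ = 1 := by simpa using hσ1
    have hlow : h ≤ ‖v - r • σ‖ := by
      have := abs_norm_sub_norm_le v (r • σ)
      rwa [norm_smul, hσ1, mul_one, Real.norm_of_nonneg hrpos.le, abs_sub_comm] at this
    have hupp : ‖v - r • σ‖ ≤ 2 * h := by
      have e : v - r • σ = (‖v‖ - r) • u + r • (u - σ) := by
        nth_rewrite 1 [hvu]
        module
      rw [e]
      refine (norm_add_le _ _).trans ?_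
      rw [norm_smul _ u, norm_smul _ (u - σ), hu1, mul_one, Real.norm_eq_abs, abs_sub_comm,
        Real.norm_of_nonneg hrpos.le, ← hh, ← dist_eq_norm, dist_comm]
      have : r * dist σ u ≤ R0 * (h / R0) := by
        gcongr
        exact hσ
      rw [mul_div_cancel₀ _ hR.ne'] at this
      linarith
    rw [rieszKernel, if_pos (by linarith)]
    exact Real.rpow_le_rpow_of_nonpos (by linarith) hupp (by linarith [n.cast_nonneg (α := ℝ)])
  have hcap : ENNReal.ofReal ((h / R0 / 2) ^ n) * m ≤
      μH[(n : ℝ)] (closedBall u (h / R0) ∩ sphere 0 1) := by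
    refine le_trans ?_ (hausdorffMeasure_closedBall_le_cap hu1 hδ)
    rw [Measure.addHaar_closedBall _ _ (by positivity), finrank_euclideanSpace_fin]
  have hint : ENNReal.ofReal (c * h ^ (-(ρ - n))) ≤
      ∫⁻ σ in sphere (0 : EuclideanSpace ℝ (Fin (n + 1))) 1,
          ENNReal.ofReal (rieszKernel ρ r0 (v - r • σ)) ∂(μH[(n : ℝ)]) := by
    calc ENNReal.ofReal (c * h ^ (-(ρ - n)))
        = ENNReal.ofReal ((2 * h) ^ (-ρ)) * (ENNReal.ofReal ((h / R0 / 2) ^ n) * m) := by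
          nth_rewrite 1 [← ENNReal.ofReal_toReal hmtop]
          rw [← ENNReal.ofReal_mul (by positivity), ← ENNReal.ofReal_mul (by positivity)]
          congr 1
          rw [hc, Real.mul_rpow two_pos.le hpos.le, neg_sub, sub_eq_add_neg,
            Real.rpow_add hpos, Real.rpow_natCast,
            show h / R0 / 2 = (1 / (2 * R0)) * h by field_simp, mul_pow]
          ring
      _ ≤ ENNReal.ofReal ((2 * h) ^ (-ρ)) *
            μH[(n : ℝ)] (closedBall u (h / R0) ∩ sphere 0 1) := by gcongr
      _ = ∫⁻ _ in closedBall u (h / R0) ∩ sphere 0 1,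
            ENNReal.ofReal ((2 * h) ^ (-ρ)) ∂(μH[(n : ℝ)]) := (setLIntegral_const _ _).symm
      _ ≤ ∫⁻ σ in closedBall u (h / R0) ∩ sphere 0 1,
            ENNReal.ofReal (rieszKernel ρ r0 (v - r • σ)) ∂(μH[(n : ℝ)]) :=
          setLIntegral_mono' (isClosed_closedBall.inter isClosed_sphere).measurableSet
            fun σ hσ => ENNReal.ofReal_le_ofReal (hker σ hσ)
      _ ≤ _ := lintegral_mono_set Set.inter_subset_right
  calc ENNReal.ofReal (rieszKernel1 (ρ - n) r1 (r - ‖v‖))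
      = ENNReal.ofReal c⁻¹ * ENNReal.ofReal (c * h ^ (-(ρ - n))) := by
        rw [rieszKernel1, if_pos hle, ← ENNReal.ofReal_mul (by positivity),
          inv_mul_cancel_left₀ hc0.ne']
    _ ≤ _ := by gcongr

/-- Lemma 2: for `d - 1 < ρ < d` and `0 < r_0 < R_0`, given a one-dimensional cutoff
`r_1 ≤ r_0/4` one can choose a `d`-dimensional cutoff `r_d` and a constant `C` so that
`(ν_x * K_{ρ+1-d})(r) ≤ C · S(ν * K_ρ)(x,r)` for all `x ∈ ℝ^d` and `r ∈ [r_0, R_0]`,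
where `ν_x` is the pushforward of `ν` under `e ↦ |x - e|`. -/
theorem stmt_2 (d : ℕ) (hd : 2 ≤ d) (ν : Measure (EuclideanSpace ℝ (Fin d)))
    [IsProbabilityMeasure ν] (ρ : ℝ) (hρ1 : (d : ℝ) - 1 < ρ) (hρ2 : ρ < d)
    (r0 R0 : ℝ) (hr0 : 0 < r0) (hR0 : r0 < R0)
    (r1 : ℝ) (hr1 : 0 < r1) (hr1' : r1 ≤ r0 / 4) :
    ∃ rd > 0, ∃ C > 0, ∀ x : EuclideanSpace ℝ (Fin d), ∀ r ∈ Set.Icc r0 R0,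
      (∫⁻ t : ℝ, ENNReal.ofReal (rieszKernel1 (ρ + 1 - d) r1 (r - t))
          ∂(ν.map fun e => dist x e))
        ≤ ENNReal.ofReal C *
          ∫⁻ σ in Metric.sphere (0 : EuclideanSpace ℝ (Fin d)) 1,
            (∫⁻ y, ENNReal.ofReal (rieszKernel ρ rd (x - r • σ - y)) ∂ν)
              ∂(μH[(d : ℝ) - 1]) := by
  obtain ⟨n, rfl⟩ : ∃ n, d = n + 1 := ⟨d - 1, by omega⟩
  have hn : ((n + 1 : ℕ) : ℝ) - 1 = n := by push_cast; ring
  have hρn : ρ + 1 - ((n + 1 : ℕ) : ℝ) = ρ - n := by push_cast; ring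
  rw [hn] at hρ1
  rw [hρn, hn]
  obtain ⟨C, hC, H⟩ := exists_rieszKernel1_le_sphericalAverage hρ1 hr0 hR0 hr1'
  refine ⟨r0, hr0, C, hC, fun x r hr => ?_⟩
  have : Fact (finrank ℝ (EuclideanSpace ℝ (Fin (n + 1))) = n + 1) := ⟨by simp⟩
  have := sigmaFinite_hausdorffMeasure_restrict_sphere
    (E := EuclideanSpace ℝ (Fin (n + 1))) (n := n) (by omega)
  have hmeas : Measurable fun p : EuclideanSpace ℝ (Fin (n + 1)) × EuclideanSpace ℝ (Fin (n + 1)) =>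
      ENNReal.ofReal (rieszKernel ρ r0 (x - r • p.1 - p.2)) :=
    ((measurable_rieszKernel ρ r0).comp (by fun_prop)).ennreal_ofReal
  have hmeas1 : Measurable fun t => ENNReal.ofReal (rieszKernel1 (ρ - n) r1 (r - t)) :=
    ((measurable_rieszKernel1 _ _).comp (by fun_prop)).ennreal_ofReal
  rw [lintegral_map hmeas1 (by fun_prop),
    lintegral_lintegral_swap hmeas.aemeasurable, ← lintegral_const_mul' _ _ ENNReal.ofReal_ne_top]
  refine lintegral_mono fun e => ?_
  simpa only [dist_eq_norm, sub_right_comm] using H (x - e) r hr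
end

section
/- Let d ≥ 2 and let λ be a nonnegative compactly supported Borel measure on ℝ^d such that for some α ∈ (0, (d−1)/2) one has λ(B(x,δ)) ≤ C δ^α for all x ∈ ℝ^d and δ > 0. Then for every ε > 0, every q with 0 < q < 2, and every 0 < r_0 < R_0 < ∞ there is a constant C' (depending on the diameter of the support of λ, on C, ε, q, r_0, R_0) such that for all Schwartz functions f on ℝ^d: (∫_{ℝ^d} (sup_{r_0 < r < R_0} |Sf(x,r)|)^q dλ(x))^{1/q} ≤ C' ‖f‖_{W^{2,(1−α)/2+ε}}. -/
open MeasureTheory Metric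

/-- The spherical average `Sf(x,r) = ∫_{S^{d-1}} f(x - rσ) dσ`, where the surface
measure on the unit sphere is realized as `(d-1)`-dimensional Hausdorff measure. -/
noncomputable def sphAvg {d : ℕ} (f : EuclideanSpace ℝ (Fin d) → ℝ)
    (x : EuclideanSpace ℝ (Fin d)) (r : ℝ) : ℝ :=
  ∫ σ in Metric.sphere (0 : EuclideanSpace ℝ (Fin d)) 1, f (x - r • σ) ∂(μH[(d : ℝ) - 1])

open FourierTransform in
/-- The `L²`-Sobolev norm of order `s`:
`‖f‖_{W^{2,s}} = (∫ (1+|ξ|²)^s |f̂(ξ)|² dξ)^{1/2}`. -/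
noncomputable def sobolevNorm {d : ℕ} (s : ℝ) (f : EuclideanSpace ℝ (Fin d) → ℝ) : ℝ :=
  (∫ ξ : EuclideanSpace ℝ (Fin d),
    (1 + ‖ξ‖ ^ 2) ^ s * ‖𝓕 (fun x => (f x : ℂ)) ξ‖ ^ 2) ^ ((1 : ℝ) / 2)

theorem lipschitzOnWith_inv_norm_smul {E : Type*} [NormedAddCommGroup E] [NormedSpace ℝ E] :
    LipschitzOnWith 2 (fun y : E => ‖y‖⁻¹ • y) {y | 1 ≤ ‖y‖} := by
  refine LipschitzOnWith.of_dist_le_mul fun y hy z hz => ?_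
  simp only [Set.mem_ofPred_eq] at hy hz
  have hy0 : 0 < ‖y‖ := by linarith
  have hz0 : 0 < ‖z‖ := by linarith
  rw [dist_eq_norm, dist_eq_norm]
  have h1 : ‖y‖⁻¹ • y - ‖z‖⁻¹ • z = ‖y‖⁻¹ • (y - z) + (‖y‖⁻¹ - ‖z‖⁻¹) • z := by
    rw [smul_sub, sub_smul]; abel
  have h2 : |‖y‖⁻¹ - ‖z‖⁻¹| * ‖z‖ = ‖y‖⁻¹ * |‖z‖ - ‖y‖| := by
    have : ‖y‖⁻¹ - ‖z‖⁻¹ = ‖y‖⁻¹ * (‖z‖ - ‖y‖) * ‖z‖⁻¹ := by field_simp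
    rw [this, abs_mul, abs_mul, abs_of_pos (inv_pos.2 hy0), abs_of_pos (inv_pos.2 hz0)]
    field_simp
  have h3 : |‖z‖ - ‖y‖| ≤ ‖y - z‖ := by
    rw [abs_sub_comm]; exact abs_norm_sub_norm_le y z
  have h4 : ‖y‖⁻¹ ≤ 1 := inv_le_one_of_one_le₀ hy
  calc ‖‖y‖⁻¹ • y - ‖z‖⁻¹ • z‖ ≤ ‖y‖⁻¹ * ‖y - z‖ + |‖y‖⁻¹ - ‖z‖⁻¹| * ‖z‖ := by
        rw [h1]
        refine (norm_add_le _ _).trans ?_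
        rw [norm_smul, norm_smul, Real.norm_eq_abs, Real.norm_eq_abs,
          abs_of_pos (inv_pos.2 hy0)]
    _ ≤ 1 * ‖y - z‖ + 1 * ‖y - z‖ := by rw [h2]; gcongr
    _ = (2 : NNReal) * ‖y - z‖ := by push_cast; ring

theorem hausdorffMeasure_sphere_lt_top (n : ℕ) :
    μH[(n : ℝ)] (sphere (0 : EuclideanSpace ℝ (Fin (n + 1))) 1) < ⊤ := by
  let φ : Fin (n + 1) → ℝ → (Fin n → ℝ) → EuclideanSpace ℝ (Fin (n + 1)) :=
    fun i s y => WithLp.toLp 2 (i.insertNth (α := fun _ => ℝ) s y)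
  have hlip : ∀ i s, ∃ K, LipschitzWith K (φ i s) := by
    intro i s
    refine ⟨_, (PiLp.lipschitzWith_toLp 2 (fun _ : Fin (n + 1) => ℝ)).comp
      (LipschitzWith.of_edist_le (f := fun y => i.insertNth (α := fun _ => ℝ) s y) ?_)⟩
    intro y z
    refine edist_pi_le_iff.2 fun j => ?_
    rcases Fin.eq_self_or_eq_succAbove i j with rfl | ⟨k, rfl⟩
    · simp
    · simpa using edist_le_pi_edist y z k
  have hnorm : ∀ i s y, |s| = 1 → 1 ≤ ‖φ i s y‖ := by
    intro i s y hs
    have := PiLp.norm_apply_le (φ i s y) i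
    simpa [φ, hs] using this
  have hface : ∀ i s, |s| = 1 →
      μH[(n : ℝ)] ((fun y => ‖y‖⁻¹ • y) '' (φ i s '' Set.Icc (-1) 1)) < ⊤ := by
    intro i s hs
    obtain ⟨K, hK⟩ := hlip i s
    have hvol : μH[(n : ℝ)] (Set.Icc (-1 : Fin n → ℝ) 1) < ⊤ := by
      have := hausdorffMeasure_pi_real (ι := Fin n)
      rw [Fintype.card_fin] at this
      rw [this]
      exact isCompact_Icc.measure_lt_top
    have h1 := hK.hausdorffMeasure_image_le (Nat.cast_nonneg n) (Set.Icc (-1 : Fin n → ℝ) 1)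
    have h2 := (lipschitzOnWith_inv_norm_smul.mono (s := φ i s '' Set.Icc (-1) 1) (by
      rintro _ ⟨y, -, rfl⟩; exact hnorm i s y hs)).hausdorffMeasure_image_le
      (Nat.cast_nonneg n)
    refine h2.trans_lt (ENNReal.mul_lt_top (by simp) (h1.trans_lt (ENNReal.mul_lt_top ?_ hvol)))
    simp
  have hcover : sphere (0 : EuclideanSpace ℝ (Fin (n + 1))) 1 ⊆
      ⋃ i : Fin (n + 1), (((fun y => ‖y‖⁻¹ • y) '' (φ i 1 '' Set.Icc (-1) 1)) ∪
        ((fun y => ‖y‖⁻¹ • y) '' (φ i (-1) '' Set.Icc (-1) 1))) := by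
    intro x hx
    have hx1 : ‖x‖ = 1 := by simpa using hx
    obtain ⟨i, -, hi⟩ := Finset.exists_max_image Finset.univ (fun i => |x i|)
      Finset.univ_nonempty
    have hxi : 0 < |x i| := by
      refine abs_pos.2 fun h0 => ?_
      have : x = 0 := by
        ext j
        have := hi j (Finset.mem_univ j)
        rw [h0, abs_zero] at this
        simpa using this
      simp [this] at hx1
    set s : ℝ := |x i|⁻¹ * x i with hs
    have hsabs : |s| = 1 := by
      rw [hs, abs_mul, abs_inv, abs_abs, inv_mul_cancel₀ hxi.ne']
    have key : x ∈ (fun y => ‖y‖⁻¹ • y) '' (φ i s '' Set.Icc (-1) 1) := by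
      refine ⟨|x i|⁻¹ • x, ⟨fun k => |x i|⁻¹ * x (i.succAbove k), ?_, ?_⟩, ?_⟩
      · rw [Set.mem_Icc, Pi.le_def, Pi.le_def, ← forall_and]
        intro k
        simp only [Pi.neg_apply, Pi.one_apply]
        rw [← abs_le, abs_mul, abs_inv, abs_abs, inv_mul_le_one₀ hxi]
        exact hi _ (Finset.mem_univ _)
      · ext j
        rcases Fin.eq_self_or_eq_succAbove i j with rfl | ⟨k, rfl⟩ <;> simp [φ, hs]
      · simp only [norm_smul, norm_inv, Real.norm_eq_abs, abs_abs, hx1, mul_one, inv_inv]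
        rw [smul_smul, mul_inv_cancel₀ hxi.ne', one_smul]
    refine Set.mem_iUnion.2 ⟨i, ?_⟩
    rcases eq_or_eq_neg_of_abs_eq hsabs with h | h
    · left; rwa [h] at key
    · right; rwa [h] at key
  refine (measure_mono hcover).trans_lt ?_
  refine (measure_iUnion_le _).trans_lt ?_
  rw [tsum_fintype]
  refine ENNReal.sum_lt_top.2 fun i _ => ?_
  exact (measure_union_le _ _).trans_lt
    (ENNReal.add_lt_top.2 ⟨hface i 1 (by simp), hface i (-1) (by simp)⟩)

/-- A measure concentrated on the unit sphere and invariant under linear isometries. -/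
structure IsRotationInvariant {d : ℕ} (σ : Measure (EuclideanSpace ℝ (Fin d))) : Prop where
  ae_norm_eq_one : ∀ᵐ ω ∂σ, ‖ω‖ = 1
  measurePreserving (L : EuclideanSpace ℝ (Fin d) ≃ₗᵢ[ℝ] EuclideanSpace ℝ (Fin d)) :
    MeasurePreserving L σ σ

theorem isRotationInvariant_hausdorffMeasure (d : ℕ) (s : ℝ) :
    IsRotationInvariant ((μH[s]).restrict (sphere (0 : EuclideanSpace ℝ (Fin d)) 1)) where
  ae_norm_eq_one := by
    filter_upwards [ae_restrict_mem isClosed_sphere.measurableSet] with ω hω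
    simpa using hω
  measurePreserving L := by
    have h := (L.toIsometryEquiv.measurePreserving_hausdorffMeasure s).restrict_preimage
      (s := sphere (0 : EuclideanSpace ℝ (Fin d)) 1) isClosed_sphere.measurableSet
    have h2 : L.toIsometryEquiv ⁻¹' sphere (0 : EuclideanSpace ℝ (Fin d)) 1 = sphere 0 1 := by
      ext; simp
    rw [h2] at h
    exact h

section SphereProfile

variable {d : ℕ} {σ : Measure (EuclideanSpace ℝ (Fin d))}

theorem abs_apply_le_one {ω : EuclideanSpace ℝ (Fin d)} (hω : ‖ω‖ = 1) (i : Fin d) :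
    |ω i| ≤ 1 := by
  have := PiLp.norm_apply_le ω i
  rwa [hω] at this

theorem IsRotationInvariant.integrable_of_bound [IsFiniteMeasure σ] (hσ : IsRotationInvariant σ)
    {F : Type*} [NormedAddCommGroup F]
    {g : EuclideanSpace ℝ (Fin d) → F} (hg : Continuous g) {C : ℝ}
    (hb : ∀ ω, ‖ω‖ = 1 → ‖g ω‖ ≤ C) : Integrable g σ :=
  Integrable.of_bound hg.aestronglyMeasurable C (hσ.ae_norm_eq_one.mono hb)

theorem IsRotationInvariant.hasDerivAt_integral [IsFiniteMeasure σ] (hσ : IsRotationInvariant σ)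
    {G G' : ℝ → EuclideanSpace ℝ (Fin d) → ℝ} (hG : ∀ t, Continuous (G t))
    (hG' : ∀ t, Continuous (G' t)) (hd : ∀ t ω, HasDerivAt (fun t => G t ω) (G' t ω) t) (C : ℝ)
    (hb : ∀ t ω, ‖ω‖ = 1 → |G t ω| ≤ C) (hb' : ∀ t ω, ‖ω‖ = 1 → |G' t ω| ≤ C) (t : ℝ) :
    HasDerivAt (fun t => ∫ ω, G t ω ∂σ) (∫ ω, G' t ω ∂σ) t :=
  (hasDerivAt_integral_of_dominated_loc_of_deriv_le (F := G) (F' := G') (bound := fun _ => C)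
    Filter.univ_mem (Filter.Eventually.of_forall fun t => (hG t).aestronglyMeasurable)
    (hσ.integrable_of_bound (hG t) (hb t)) (hG' t).aestronglyMeasurable
    (hσ.ae_norm_eq_one.mono fun ω hω x _ => hb' x ω hω) (integrable_const C)
    (Filter.Eventually.of_forall fun ω x _ => hd x ω)).2

/-- The profile `t ↦ ∫ cos (t ω_i) dσ(ω)` of the Fourier transform of `σ`. -/
noncomputable def sphereProfile (σ : Measure (EuclideanSpace ℝ (Fin d))) (i : Fin d) (t : ℝ) : ℝ :=
  ∫ ω, Real.cos (t * ω i) ∂σ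

/-- The derivative of `sphereProfile`. -/
noncomputable def sphereProfileDeriv (σ : Measure (EuclideanSpace ℝ (Fin d))) (i : Fin d)
    (t : ℝ) : ℝ :=
  ∫ ω, -(ω i * Real.sin (t * ω i)) ∂σ

theorem IsRotationInvariant.integral_comp_inner (hσ : IsRotationInvariant σ) {F : Type*}
    [NormedAddCommGroup F] [NormedSpace ℝ F] (g : ℝ → F) {v w : EuclideanSpace ℝ (Fin d)}
    (hvw : ‖v‖ = ‖w‖) : ∫ ω, g (inner ℝ v ω) ∂σ = ∫ ω, g (inner ℝ w ω) ∂σ := by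
  set L := (ℝ ∙ (v - w))ᗮ.reflection with hL
  have hLv : L v = w := Submodule.reflection_sub hvw
  have h := (hσ.measurePreserving L).integral_comp L.toHomeomorph.measurableEmbedding
    (fun ω => g (inner ℝ w ω))
  rw [← h]
  refine integral_congr_ae (Filter.Eventually.of_forall fun ω => ?_)
  simp only [← hLv, LinearIsometryEquiv.inner_map_map]

theorem IsRotationInvariant.integral_cos_inner (hσ : IsRotationInvariant σ) (i : Fin d)
    (v : EuclideanSpace ℝ (Fin d)) :
    ∫ ω, Real.cos (inner ℝ v ω) ∂σ = sphereProfile σ i ‖v‖ := by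
  rw [hσ.integral_comp_inner Real.cos (w := ‖v‖ • EuclideanSpace.single i 1)
    (by simp [norm_smul])]
  simp [sphereProfile, real_inner_smul_left, EuclideanSpace.inner_single_left]

theorem IsRotationInvariant.integral_sin_inner (hσ : IsRotationInvariant σ)
    (v : EuclideanSpace ℝ (Fin d)) : ∫ ω, Real.sin (inner ℝ v ω) ∂σ = 0 := by
  have h := hσ.integral_comp_inner Real.sin (v := v) (w := -v) (by simp)
  simp only [inner_neg_left, Real.sin_neg, integral_neg] at h
  linarith

variable [IsFiniteMeasure σ]

theorem IsRotationInvariant.hasDerivAt_sphereProfile (hσ : IsRotationInvariant σ) (i : Fin d)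
    (t : ℝ) : HasDerivAt (sphereProfile σ i) (sphereProfileDeriv σ i t) t := by
  refine hσ.hasDerivAt_integral (G := fun t ω => Real.cos (t * ω i))
    (G' := fun t ω => -(ω i * Real.sin (t * ω i))) (fun t => by fun_prop) (fun t => by fun_prop)
    (fun t ω => ?_) 1 (fun t ω _ => Real.abs_cos_le_one _) (fun t ω hω => ?_) t
  · exact ((hasDerivAt_mul_const (ω i)).cos).congr_deriv (by ring)
  · rw [abs_neg, abs_mul]
    exact mul_le_one₀ (abs_apply_le_one hω i) (abs_nonneg _) (Real.abs_sin_le_one _)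

theorem IsRotationInvariant.hasDerivAt_sphereProfileDeriv (hσ : IsRotationInvariant σ) (i : Fin d)
    (t : ℝ) : HasDerivAt (sphereProfileDeriv σ i) (-∫ ω, ω i ^ 2 * Real.cos (t * ω i) ∂σ) t := by
  rw [← integral_neg]
  refine hσ.hasDerivAt_integral (G := fun t ω => -(ω i * Real.sin (t * ω i)))
    (G' := fun t ω => -(ω i ^ 2 * Real.cos (t * ω i))) (fun t => by fun_prop)
    (fun t => by fun_prop) (fun t ω => ?_) 1 (fun t ω hω => ?_) (fun t ω hω => ?_) t
  · exact (((hasDerivAt_mul_const (ω i)).sin.const_mul (ω i)).neg).congr_deriv (by ring)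
  · rw [abs_neg, abs_mul]
    exact mul_le_one₀ (abs_apply_le_one hω i) (abs_nonneg _) (Real.abs_sin_le_one _)
  · rw [abs_neg, abs_mul, abs_pow]
    exact mul_le_one₀ (pow_le_one₀ (abs_nonneg _) (abs_apply_le_one hω i)) (abs_nonneg _)
      (Real.abs_cos_le_one _)

theorem IsRotationInvariant.integral_cexp_inner (hσ : IsRotationInvariant σ) (i : Fin d)
    (v : EuclideanSpace ℝ (Fin d)) :
    ∫ ω, Complex.exp ((inner ℝ v ω : ℝ) * Complex.I) ∂σ = (sphereProfile σ i ‖v‖ : ℂ) := by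
  have h1 : Integrable (fun ω => ((Real.cos (inner ℝ v ω) : ℝ) : ℂ)) σ :=
    hσ.integrable_of_bound (C := 1) (by fun_prop) fun ω _ => by
      rw [Complex.norm_real]; exact Real.abs_cos_le_one _
  have h2 : Integrable (fun ω => ((Real.sin (inner ℝ v ω) : ℝ) : ℂ) * Complex.I) σ :=
    hσ.integrable_of_bound (C := 1) (by fun_prop) fun ω _ => by
      rw [norm_mul, Complex.norm_real, Complex.norm_I, mul_one]; exact Real.abs_sin_le_one _
  simp only [Complex.exp_mul_I, ← Complex.ofReal_cos, ← Complex.ofReal_sin]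
  rw [integral_add h1 h2, integral_mul_const, integral_complex_ofReal,
    integral_complex_ofReal, hσ.integral_cos_inner i, hσ.integral_sin_inner]
  simp

theorem IsRotationInvariant.integral_sq_mul_cos (hσ : IsRotationInvariant σ) {i j : Fin d}
    (hij : i ≠ j) (t : ℝ) :
    t ^ 2 * ∫ ω, ω j ^ 2 * Real.cos (t * ω i) ∂σ = -(t * sphereProfileDeriv σ i t) := by
  let A : ℝ → EuclideanSpace ℝ (Fin d) → ℝ :=
    fun θ ω => t * (Real.cos θ * ω i + Real.sin θ * ω j)
  let B : ℝ → EuclideanSpace ℝ (Fin d) → ℝ :=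
    fun θ ω => t * (-Real.sin θ * ω i + Real.cos θ * ω j)
  have hA : ∀ θ ω, HasDerivAt (fun θ => A θ ω) (B θ ω) θ := fun θ ω =>
    (((Real.hasDerivAt_cos θ).mul_const (ω i)).add
      ((Real.hasDerivAt_sin θ).mul_const (ω j))).const_mul t
  have hB : ∀ θ ω, HasDerivAt (fun θ => B θ ω) (-A θ ω) θ := fun θ ω =>
    ((((Real.hasDerivAt_sin θ).neg.mul_const (ω i)).add
      ((Real.hasDerivAt_cos θ).mul_const (ω j))).const_mul t).congr_deriv (by simp only [A]; ring)
  have hbound : ∀ a b : ℝ, |a| ≤ 1 → |b| ≤ 1 → ∀ ω : EuclideanSpace ℝ (Fin d), ‖ω‖ = 1 →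
      |t * (a * ω i + b * ω j)| ≤ 2 * |t| := by
    intro a b ha hb ω hω
    rw [abs_mul, mul_comm]
    refine mul_le_mul_of_nonneg_right ((abs_add_le _ _).trans ?_) (abs_nonneg t)
    rw [abs_mul, abs_mul]
    have h1 := mul_le_one₀ ha (abs_nonneg _) (abs_apply_le_one hω i)
    have h2 := mul_le_one₀ hb (abs_nonneg _) (abs_apply_le_one hω j)
    linarith
  have hAb : ∀ θ ω, ‖ω‖ = 1 → |A θ ω| ≤ 2 * |t| := fun θ =>
    hbound _ _ (Real.abs_cos_le_one θ) (Real.abs_sin_le_one θ)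
  have hBb : ∀ θ ω, ‖ω‖ = 1 → |B θ ω| ≤ 2 * |t| := fun θ =>
    hbound _ _ ((abs_neg _).trans_le (Real.abs_sin_le_one θ)) (Real.abs_cos_le_one θ)
  have hAc : ∀ θ, Continuous (A θ) := fun θ => by fun_prop
  have hBc : ∀ θ, Continuous (B θ) := fun θ => by fun_prop
  set M : ℝ := 2 * |t| with hM
  have hM0 : 0 ≤ M := by positivity
  have hconst : ∀ θ, ∫ ω, Real.cos (A θ ω) ∂σ = ∫ ω, Real.cos (A 0 ω) ∂σ := by
    have hrot : ∀ θ, ∫ ω, Real.cos (A θ ω) ∂σ = sphereProfile σ i |t| := by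
      intro θ
      have h := hσ.integral_cos_inner i (t • (Real.cos θ • EuclideanSpace.single i (1 : ℝ) +
        Real.sin θ • EuclideanSpace.single j (1 : ℝ)))
      have hn : ‖t • (Real.cos θ • EuclideanSpace.single i (1 : ℝ) +
          Real.sin θ • EuclideanSpace.single j (1 : ℝ))‖ = |t| := by
        have h0 : ‖Real.cos θ • EuclideanSpace.single i (1 : ℝ) +
          Real.sin θ • EuclideanSpace.single j (1 : ℝ)‖ ^ 2 = 1 := by
          rw [norm_add_sq_real]
          simp [norm_smul, real_inner_smul_left, real_inner_smul_right,
            EuclideanSpace.inner_single_left, hij]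
        rw [norm_smul, (pow_eq_one_iff_of_nonneg (norm_nonneg _) two_ne_zero).1 h0, mul_one,
          Real.norm_eq_abs]
      rw [hn] at h
      rw [← h]
      simp [A, inner_add_left, real_inner_smul_left, EuclideanSpace.inner_single_left, mul_add]
    intro θ
    rw [hrot, hrot]
  have hfirst : ∀ θ, ∫ ω, -Real.sin (A θ ω) * B θ ω ∂σ = 0 := by
    intro θ
    have h := hσ.hasDerivAt_integral (G := fun θ ω => Real.cos (A θ ω))
      (G' := fun θ ω => -Real.sin (A θ ω) * B θ ω) (fun θ => by fun_prop) (fun θ => by fun_prop)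
      (fun θ ω => (hA θ ω).cos) (1 + M)
      (fun θ ω _ => (Real.abs_cos_le_one _).trans (by linarith)) (fun θ ω hω => by
        rw [abs_mul, abs_neg]
        have := mul_le_mul (Real.abs_sin_le_one (A θ ω)) (hBb θ ω hω) (abs_nonneg _) zero_le_one
        linarith) θ
    rw [funext hconst] at h
    exact h.unique (hasDerivAt_const _ _)
  have hsecond : ∫ ω, (-(Real.cos (A 0 ω) * B 0 ω) * B 0 ω + -Real.sin (A 0 ω) * -A 0 ω) ∂σ
      = 0 := by
    have h := hσ.hasDerivAt_integral (G := fun θ ω => -Real.sin (A θ ω) * B θ ω)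
      (G' := fun θ ω => -(Real.cos (A θ ω) * B θ ω) * B θ ω + -Real.sin (A θ ω) * -A θ ω)
      (fun θ => by fun_prop) (fun θ => by fun_prop)
      (fun θ ω => (hA θ ω).sin.neg.mul (hB θ ω)) (M + M * M)
      (fun θ ω hω => by
        rw [abs_mul, abs_neg]
        have := mul_le_mul (Real.abs_sin_le_one (A θ ω)) (hBb θ ω hω) (abs_nonneg _) zero_le_one
        nlinarith) (fun θ ω hω => by
        refine (abs_add_le _ _).trans ?_
        rw [abs_mul (-(Real.cos (A θ ω) * B θ ω)), abs_neg, abs_mul (Real.cos _),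
          abs_mul (-Real.sin _), abs_neg, abs_neg]
        have h1 := mul_le_mul (Real.abs_sin_le_one (A θ ω)) (hAb θ ω hω) (abs_nonneg _) zero_le_one
        have h2 := mul_le_mul (Real.abs_cos_le_one (A θ ω)) (hBb θ ω hω) (abs_nonneg _) zero_le_one
        have h3 := mul_le_mul h2 (hBb θ ω hω) (abs_nonneg _) (by linarith)
        linarith) 0
    rw [funext hfirst] at h
    exact h.unique (hasDerivAt_const _ _)
  have hI1 : Integrable (fun ω : EuclideanSpace ℝ (Fin d) => ω j ^ 2 * Real.cos (t * ω i)) σ :=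
    hσ.integrable_of_bound (C := 1) (by fun_prop) fun ω hω => by
      rw [Real.norm_eq_abs, abs_mul, abs_pow]
      exact mul_le_one₀ (pow_le_one₀ (abs_nonneg _) (abs_apply_le_one hω j)) (abs_nonneg _)
        (Real.abs_cos_le_one _)
  have hI2 : Integrable (fun ω : EuclideanSpace ℝ (Fin d) => -(ω i * Real.sin (t * ω i))) σ :=
    hσ.integrable_of_bound (C := 1) (by fun_prop) fun ω hω => by
      rw [norm_neg, Real.norm_eq_abs, abs_mul]
      exact mul_le_one₀ (abs_apply_le_one hω i) (abs_nonneg _) (Real.abs_sin_le_one _)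
  have hsplit : ∀ ω, -(Real.cos (A 0 ω) * B 0 ω) * B 0 ω + -Real.sin (A 0 ω) * -A 0 ω =
      -(t ^ 2 * (ω j ^ 2 * Real.cos (t * ω i))) - t * (-(ω i * Real.sin (t * ω i))) := by
    intro ω
    simp only [A, B, Real.cos_zero, Real.sin_zero]
    ring_nf
  rw [integral_congr_ae (Filter.Eventually.of_forall hsplit),
    integral_sub (f := fun ω => -(t ^ 2 * (ω j ^ 2 * Real.cos (t * ω i))))
      (hI1.const_mul _).neg (hI2.const_mul _), integral_neg, integral_const_mul,
    integral_const_mul] at hsecond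
  unfold sphereProfileDeriv
  linarith

theorem IsRotationInvariant.bessel_equation (hσ : IsRotationInvariant σ) (i : Fin d) {t : ℝ}
    (ht : t ≠ 0) :
    -∫ ω, ω i ^ 2 * Real.cos (t * ω i) ∂σ =
      -sphereProfile σ i t - ((d - 1 : ℕ) : ℝ) / t * sphereProfileDeriv σ i t := by
  have hI : ∀ j, Integrable
      (fun ω : EuclideanSpace ℝ (Fin d) => ω j ^ 2 * Real.cos (t * ω i)) σ := fun j =>
    hσ.integrable_of_bound (C := 1) (by fun_prop) fun ω hω => by
      rw [Real.norm_eq_abs, abs_mul, abs_pow]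
      exact mul_le_one₀ (pow_le_one₀ (abs_nonneg _) (abs_apply_le_one hω j)) (abs_nonneg _)
        (Real.abs_cos_le_one _)
  have h1 : sphereProfile σ i t = ∑ j, ∫ ω, ω j ^ 2 * Real.cos (t * ω i) ∂σ := by
    rw [← integral_finsetSum _ fun j _ => hI j]
    refine integral_congr_ae (hσ.ae_norm_eq_one.mono fun ω hω => ?_)
    have : ∑ j, ω j ^ 2 = 1 := by
      rw [← EuclideanSpace.real_norm_sq_eq, hω, one_pow]
    simp only [← Finset.sum_mul, this, one_mul]
  have h2 : ∀ j ∈ Finset.univ.erase i, ∫ ω, ω j ^ 2 * Real.cos (t * ω i) ∂σ =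
      -(sphereProfileDeriv σ i t / t) := fun j hj => by
    have := hσ.integral_sq_mul_cos (Finset.ne_of_mem_erase hj).symm t
    field_simp
    have h3 : t * (t * ∫ ω, ω j ^ 2 * Real.cos (t * ω i) ∂σ) = t * -sphereProfileDeriv σ i t := by
      linarith
    exact mul_left_cancel₀ ht h3
  rw [← Finset.add_sum_erase _ _ (Finset.mem_univ i), Finset.sum_congr rfl h2, Finset.sum_const,
    Finset.card_erase_of_mem (Finset.mem_univ i), Finset.card_univ, Fintype.card_fin,
    nsmul_eq_mul] at h1
  rw [h1]
  ring

theorem IsRotationInvariant.abs_sphereProfile_le (i : Fin d) (t : ℝ) :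
    |sphereProfile σ i t| ≤ σ.real Set.univ := by
  have := norm_integral_le_of_norm_le_const (μ := σ)
    (f := fun ω : EuclideanSpace ℝ (Fin d) => Real.cos (t * ω i)) (C := 1)
    (Filter.Eventually.of_forall fun ω => Real.abs_cos_le_one _)
  simpa [sphereProfile] using this

end SphereProfile

theorem bessel_energy_antitoneOn {u u' : ℝ → ℝ} (k : ℕ) (hu : ∀ t > 0, HasDerivAt u (u' t) t)
    (hu' : ∀ t > 0, HasDerivAt u' (-u t - k / t * u' t) t) {t₀ : ℝ} (ht₀ : 0 < t₀) :
    AntitoneOn (fun t => t ^ k * ((u' t + (k / 2 : ℝ) * u t / t) ^ 2 + u t ^ 2) *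
      Real.exp (|(k / 2 : ℝ) ^ 2 - k / 2| / t)) (Set.Ici t₀) := by
  set β : ℝ := k / 2 with hβ
  set κ : ℝ := |β ^ 2 - β| with hκ
  have hkβ : (k : ℝ) = 2 * β := by rw [hβ]; ring
  have hder : ∀ t > 0, HasDerivAt (fun t => t ^ k * ((u' t + β * u t / t) ^ 2 + u t ^ 2) *
      Real.exp (κ / t)) (Real.exp (κ / t) * t ^ k / t ^ 2 *
        (2 * (β ^ 2 - β) * (u' t + β * u t / t) * u t -
          κ * ((u' t + β * u t / t) ^ 2 + u t ^ 2))) t := by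
    intro t ht
    have hp : HasDerivAt (fun t => u' t + β * u t / t)
        ((-u t - k / t * u' t) + (β * u' t * t - β * u t * 1) / t ^ 2) t :=
      (hu' t ht).add (((hu t ht).const_mul β).div (hasDerivAt_id t) ht.ne')
    have he : HasDerivAt (fun t => Real.exp (κ / t)) (Real.exp (κ / t) * (κ * -(t ^ 2)⁻¹)) t :=
      ((hasDerivAt_inv ht.ne').const_mul κ).exp
    have hpow : HasDerivAt (fun t : ℝ => t ^ k) (k * t ^ k / t) t := by
      refine (hasDerivAt_pow k t).congr_deriv ?_
      rcases k with _ | k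
      · simp
      · field_simp; simp [pow_succ]
    refine (((hpow.mul ((hp.pow 2).add ((hu t ht).pow 2))).mul he)).congr_deriv ?_
    simp only [hkβ, Pi.add_apply, Pi.mul_apply, Pi.pow_apply, Nat.add_one_sub_one, pow_one,
      Nat.cast_ofNat]
    have htne : t ≠ 0 := ht.ne'
    clear_value β κ
    generalize u t = x
    generalize u' t = y
    field_simp
    ring
  refine antitoneOn_of_deriv_nonpos (convex_Ici t₀)
    (fun t ht => (hder t (ht₀.trans_le ht)).continuousAt.continuousWithinAt)
    (fun t ht => (hder t (ht₀.trans (by simpa using ht))).differentiableAt.differentiableWithinAt)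
    fun t ht => ?_
  have ht0 : 0 < t := ht₀.trans (by simpa using ht)
  rw [(hder t ht0).deriv]
  refine mul_nonpos_of_nonneg_of_nonpos (by positivity) ?_
  set p := u' t + β * u t / t
  have h1 : 2 * (β ^ 2 - β) * p * u t ≤ κ * (2 * |p * u t|) := by
    have := le_abs_self ((β ^ 2 - β) * (p * u t))
    rw [abs_mul] at this
    linarith
  have h2 : 2 * |p * u t| ≤ p ^ 2 + u t ^ 2 := by
    rw [abs_mul, ← sq_abs p, ← sq_abs (u t)]
    nlinarith [sq_nonneg (|p| - |u t|)]
  have := mul_le_mul_of_nonneg_left h2 (abs_nonneg (β ^ 2 - β))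
  linarith

theorem bessel_decay {u u' : ℝ → ℝ} (k : ℕ) (hu : ∀ t > 0, HasDerivAt u (u' t) t)
    (hu' : ∀ t > 0, HasDerivAt u' (-u t - k / t * u' t) t) {t₀ : ℝ} (ht₀ : 0 < t₀) :
    ∃ C : ℝ, 0 ≤ C ∧ ∀ t, t₀ ≤ t →
      |u t| ≤ C * t ^ (-(k / 2 : ℝ)) ∧ |u' t| ≤ C * t ^ (-(k / 2 : ℝ)) := by
  have hanti := bessel_energy_antitoneOn k hu hu' ht₀
  set β : ℝ := k / 2 with hβ
  have hβ0 : 0 ≤ β := by positivity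
  set D := t₀ ^ k * ((u' t₀ + β * u t₀ / t₀) ^ 2 + u t₀ ^ 2) * Real.exp (|β ^ 2 - β| / t₀) with hD
  have hD0 : 0 ≤ D := by positivity
  refine ⟨Real.sqrt D * (1 + β / t₀), by positivity, fun t ht => ?_⟩
  have ht0 : 0 < t := ht₀.trans_le ht
  have hE : t ^ k * ((u' t + β * u t / t) ^ 2 + u t ^ 2) ≤ D := by
    refine le_trans ?_ (hanti (Set.self_mem_Ici) ht ht)
    refine le_mul_of_one_le_right (by positivity) (Real.one_le_exp (by positivity))
  have htk : (t ^ (-β)) ^ 2 * t ^ k = 1 := by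
    rw [← Real.rpow_natCast (t ^ (-β)), ← Real.rpow_mul ht0.le, ← Real.rpow_natCast t k,
      ← Real.rpow_add ht0, hβ]
    norm_num
  have key : ∀ x : ℝ, t ^ k * x ^ 2 ≤ D → |x| ≤ Real.sqrt D * t ^ (-β) := by
    intro x hx
    refine abs_le_of_sq_le_sq ?_ (by positivity)
    rw [mul_pow, Real.sq_sqrt hD0]
    calc x ^ 2 = t ^ k * x ^ 2 * (t ^ (-β)) ^ 2 := by
          rw [mul_right_comm, mul_comm (t ^ k), htk, one_mul]
      _ ≤ D * (t ^ (-β)) ^ 2 := by gcongr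
  have hq := key (u t) (le_trans (by gcongr; nlinarith [sq_nonneg (u' t + β * u t / t)]) hE)
  have hp := key (u' t + β * u t / t) (le_trans (by gcongr; nlinarith [sq_nonneg (u t)]) hE)
  have hpos : 0 ≤ Real.sqrt D * t ^ (-β) := by positivity
  have hβt : β / t ≤ β / t₀ := by gcongr
  have hβt0 : 0 ≤ β / t₀ := by positivity
  constructor
  · refine hq.trans ?_
    nlinarith
  · have h3 : u' t = (u' t + β * u t / t) - β / t * u t := by ring
    have h4 : |β / t * u t| ≤ β / t₀ * (Real.sqrt D * t ^ (-β)) := by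
      rw [abs_mul, abs_of_nonneg (by positivity : 0 ≤ β / t)]
      gcongr
    calc |u' t| ≤ |u' t + β * u t / t| + |β / t * u t| := by
          conv_lhs => rw [h3]
          exact abs_sub _ _
      _ ≤ Real.sqrt D * t ^ (-β) + β / t₀ * (Real.sqrt D * t ^ (-β)) := add_le_add hp h4
      _ = Real.sqrt D * (1 + β / t₀) * t ^ (-β) := by ring

theorem lintegral_one_add_mul_dist_rpow_le {X : Type*} [PseudoMetricSpace X] [MeasurableSpace X]
    [OpensMeasurableSpace X] {μ : Measure X} {α β C : ℝ} (hαβ : α < β) (hβ : 0 ≤ β)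
    (hfrost : ∀ (x : X) (δ : ℝ), 0 < δ → μ (ball x δ) ≤ ENNReal.ofReal (C * δ ^ α)) :
    ∃ A : ℝ, 0 ≤ A ∧ ∀ x, ∀ N : ℝ, 0 < N →
      ∫⁻ y, ENNReal.ofReal ((1 + N * dist x y) ^ (-β)) ∂μ ≤ ENNReal.ofReal (A * N ^ (-α)) := by
  have hρ0 : 0 ≤ (2 : ℝ) ^ (α - β) := by positivity
  have hρ1 : (2 : ℝ) ^ (α - β) < 1 := Real.rpow_lt_one_of_one_lt_of_neg one_lt_two (by linarith)
  refine ⟨2 ^ β * |C| * (1 - 2 ^ (α - β))⁻¹, ?_, fun x N hN => ?_⟩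
  · have : 0 ≤ 1 - (2 : ℝ) ^ (α - β) := by linarith
    positivity
  have hpt : ∀ y, ENNReal.ofReal ((1 + N * dist x y) ^ (-β)) ≤
      ∑' k : ℕ, (ball x (2 ^ k / N)).indicator
        (fun _ => ENNReal.ofReal (2 ^ β * ((2 : ℝ) ^ k) ^ (-β))) y := by
    intro y
    set t := N * dist x y with ht
    have ht0 : 0 ≤ t := by positivity
    have hex : ∃ k : ℕ, t < 2 ^ k := pow_unbounded_of_one_lt t one_lt_two
    classical
    set k := Nat.find hex with hk
    have hk1 : t < 2 ^ k := Nat.find_spec hex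
    refine le_trans ?_ (ENNReal.le_tsum k)
    rw [Set.indicator_of_mem]
    · refine ENNReal.ofReal_le_ofReal ?_
      rw [show (2 : ℝ) ^ β * ((2 : ℝ) ^ k) ^ (-β) = (2 ^ k / 2) ^ (-β) by
        rw [Real.div_rpow (by positivity) (by norm_num), Real.rpow_neg zero_le_two β]
        field_simp]
      refine Real.rpow_le_rpow_of_nonpos (by positivity) ?_ (by linarith)
      rcases Nat.eq_zero_or_pos k with h0 | hpos
      · rw [h0]; norm_num; linarith
      · have := Nat.find_min hex (m := k - 1) (by omega)
        rw [not_lt] at this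
        have h2 : (2 : ℝ) ^ k / 2 = 2 ^ (k - 1) := by
          obtain ⟨j, hj⟩ : ∃ j, k = j + 1 := ⟨k - 1, by omega⟩
          rw [hj, pow_succ]; simp
        linarith
    · rw [mem_ball', lt_div_iff₀ hN, mul_comm]
      exact hk1
  calc ∫⁻ y, ENNReal.ofReal ((1 + N * dist x y) ^ (-β)) ∂μ
      ≤ ∫⁻ y, ∑' k : ℕ, (ball x (2 ^ k / N)).indicator
        (fun _ => ENNReal.ofReal (2 ^ β * ((2 : ℝ) ^ k) ^ (-β))) y ∂μ := lintegral_mono hpt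
    _ = ∑' k : ℕ, ENNReal.ofReal (2 ^ β * ((2 : ℝ) ^ k) ^ (-β)) * μ (ball x (2 ^ k / N)) := by
      rw [lintegral_tsum fun k => (measurable_const.indicator measurableSet_ball).aemeasurable]
      simp only [lintegral_indicator_const measurableSet_ball]
    _ ≤ ∑' k : ℕ, ENNReal.ofReal (2 ^ β * |C| * N ^ (-α) * (2 ^ (α - β)) ^ k) := by
      refine ENNReal.tsum_le_tsum fun k => ?_
      have h1 : μ (ball x (2 ^ k / N)) ≤ ENNReal.ofReal (|C| * (2 ^ k / N) ^ α) :=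
        (hfrost x _ (by positivity)).trans
          (ENNReal.ofReal_le_ofReal (by gcongr; exact le_abs_self C))
      refine (mul_le_mul_right h1 _).trans_eq ?_
      rw [← ENNReal.ofReal_mul (by positivity)]
      congr 1
      have h2 : ((2 : ℝ) ^ (α - β)) ^ k = ((2 : ℝ) ^ k) ^ α * ((2 : ℝ) ^ k) ^ (-β) := by
        rw [← Real.rpow_add (by positivity), ← sub_eq_add_neg, ← Real.rpow_natCast,
          ← Real.rpow_natCast, ← Real.rpow_mul zero_le_two, ← Real.rpow_mul zero_le_two, mul_comm]
      rw [h2, Real.div_rpow (by positivity) hN.le, Real.rpow_neg hN.le]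
      ring
    _ = ENNReal.ofReal (2 ^ β * |C| * (1 - 2 ^ (α - β))⁻¹ * N ^ (-α)) := by
      rw [← ENNReal.ofReal_tsum_of_nonneg (fun k => by positivity)
        ((summable_geometric_of_lt_one hρ0 hρ1).mul_left _), tsum_mul_left,
        tsum_geometric_of_lt_one hρ0 hρ1]
      congr 1; ring

/-- The shell `n ≤ ‖ξ‖ < n + 1`. -/
def unitShell (E : Type*) [Norm E] (n : ℕ) : Set E :=
  {ξ | (n : ℝ) ≤ ‖ξ‖ ∧ ‖ξ‖ < n + 1}

theorem measurableSet_unitShell {E : Type*} [NormedAddCommGroup E] [MeasurableSpace E]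
    [BorelSpace E] (n : ℕ) : MeasurableSet (unitShell E n) :=
  (measurableSet_le measurable_const measurable_norm).inter
    (measurableSet_lt measurable_norm measurable_const)

theorem add_one_pow_sub_pow_le (x : ℝ) (hx : 0 ≤ x) (k : ℕ) :
    (x + 1) ^ (k + 1) - x ^ (k + 1) ≤ (k + 1) * (x + 1) ^ k := by
  induction k with
  | zero => simp
  | succ k ih =>
    have h1 : x ^ (k + 1) ≤ (x + 1) ^ (k + 1) := by gcongr; linarith
    have h2 := mul_le_mul_of_nonneg_left ih (by linarith : 0 ≤ x + 1)
    push_cast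
    have h3 : (x + 1) * ((k + 1) * (x + 1) ^ k) = (k + 1) * (x + 1) ^ (k + 1) := by ring
    have h4 : (x + 1) ^ (k + 1 + 1) - x ^ (k + 1 + 1) =
        (x + 1) * ((x + 1) ^ (k + 1) - x ^ (k + 1)) + x ^ (k + 1) := by ring
    rw [h4]
    linarith

theorem exists_volume_unitShell_le (d : ℕ) : ∃ V : ℝ, 0 ≤ V ∧ ∀ n : ℕ,
    volume (unitShell (EuclideanSpace ℝ (Fin (d + 1))) n) ≤
      ENNReal.ofReal (V * ((n : ℝ) + 1) ^ d) := by
  set B := (volume (ball (0 : EuclideanSpace ℝ (Fin (d + 1))) 1)).toReal with hB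
  have hBe : volume (ball (0 : EuclideanSpace ℝ (Fin (d + 1))) 1) = ENNReal.ofReal B :=
    (ENNReal.ofReal_toReal measure_ball_lt_top.ne).symm
  have hball : ∀ r : ℝ, 0 ≤ r → volume (ball (0 : EuclideanSpace ℝ (Fin (d + 1))) r) =
      ENNReal.ofReal (r ^ (d + 1) * B) := by
    intro r hr
    rw [Measure.addHaar_ball _ _ hr, finrank_euclideanSpace_fin, hBe,
      ENNReal.ofReal_mul (by positivity)]
  refine ⟨(d + 1) * B, by positivity, fun n => ?_⟩
  have hsub : unitShell (EuclideanSpace ℝ (Fin (d + 1))) n =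
      ball 0 (n + 1) \ ball 0 n := by
    ext ξ
    simp [unitShell, and_comm]
  rw [hsub, measure_sdiff (ball_subset_ball (by linarith)) measurableSet_ball.nullMeasurableSet
    measure_ball_lt_top.ne, hball _ (by positivity), hball _ (by positivity),
    ← ENNReal.ofReal_sub _ (by positivity), ← sub_mul]
  refine ENNReal.ofReal_le_ofReal ?_
  have := add_one_pow_sub_pow_le n n.cast_nonneg d
  calc _ ≤ (d + 1) * ((n : ℝ) + 1) ^ d * B := by gcongr
    _ = _ := by ring

section ShellKernel

variable {d : ℕ}

theorem volume_unitShell_lt_top (n : ℕ) :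
    volume (unitShell (EuclideanSpace ℝ (Fin d)) n) < ⊤ :=
  (measure_mono fun ξ hξ => by simpa using hξ.2).trans_lt
    (measure_ball_lt_top (x := (0 : EuclideanSpace ℝ (Fin d))) (r := (n : ℝ) + 1))

instance (n : ℕ) :
    IsFiniteMeasure (volume.restrict (unitShell (EuclideanSpace ℝ (Fin d)) n)) :=
  ⟨by simpa using volume_unitShell_lt_top n⟩

/-- The inverse Fourier transform of the indicator function of a shell. -/
noncomputable def shellKernel (n : ℕ) (z : EuclideanSpace ℝ (Fin d)) : ℂ :=
  ∫ ξ in unitShell (EuclideanSpace ℝ (Fin d)) n,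
    Complex.exp ((2 * Real.pi * inner ℝ z ξ : ℝ) * Complex.I)

theorem shellKernel_eq_of_norm_eq (n : ℕ) {v w : EuclideanSpace ℝ (Fin d)} (hvw : ‖v‖ = ‖w‖) :
    shellKernel n v = shellKernel n w := by
  set L := (ℝ ∙ (v - w))ᗮ.reflection with hL
  have hLv : L v = w := Submodule.reflection_sub hvw
  have hmp := L.measurePreserving.restrict_preimage
    (measurableSet_unitShell (E := EuclideanSpace ℝ (Fin d)) n)
  have hpre : L ⁻¹' unitShell (EuclideanSpace ℝ (Fin d)) n = unitShell _ n := by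
    ext; simp [unitShell]
  rw [hpre] at hmp
  have h := hmp.integral_comp L.toHomeomorph.measurableEmbedding
    (fun ξ => Complex.exp ((2 * Real.pi * inner ℝ w ξ : ℝ) * Complex.I))
  rw [shellKernel, shellKernel, ← h]
  simp only [← hLv, LinearIsometryEquiv.inner_map_map]

theorem IsRotationInvariant.norm_shellKernel_le {σ : Measure (EuclideanSpace ℝ (Fin d))}
    [IsFiniteMeasure σ] (hσ : IsRotationInvariant σ) (hσ0 : σ ≠ 0) (i : Fin d) {β C : ℝ}
    (hβ : 0 ≤ β) (hC : 0 ≤ C) (hdecay : ∀ t, 0 ≤ t → |sphereProfile σ i t| ≤ C * (1 + t) ^ (-β))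
    (n : ℕ) (z : EuclideanSpace ℝ (Fin d)) :
    ‖shellKernel n z‖ ≤ C / σ.real Set.univ * volume.real (unitShell (EuclideanSpace ℝ (Fin d)) n) *
      (1 + n * ‖z‖) ^ (-β) := by
  have hm : 0 < σ.real Set.univ := by
    rw [measureReal_def]
    exact ENNReal.toReal_pos (by simpa using hσ0) (measure_ne_top _ _)
  have h1 : ∫ ω, shellKernel n (‖z‖ • ω) ∂σ = σ.real Set.univ • shellKernel n z := by
    rw [← integral_const]
    refine integral_congr_ae (hσ.ae_norm_eq_one.mono fun ω hω => ?_)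
    exact shellKernel_eq_of_norm_eq n (by simp [norm_smul, hω])
  have h2 : ∫ ω, shellKernel n (‖z‖ • ω) ∂σ =
      ∫ ξ in unitShell (EuclideanSpace ℝ (Fin d)) n,
        (sphereProfile σ i (2 * Real.pi * ‖z‖ * ‖ξ‖) : ℂ) := by
    unfold shellKernel
    rw [integral_integral_swap]
    · refine integral_congr_ae (Filter.Eventually.of_forall fun ξ => ?_)
      have := hσ.integral_cexp_inner i ((2 * Real.pi * ‖z‖) • ξ)
      rw [norm_smul, Real.norm_eq_abs, abs_of_nonneg (by positivity)] at this
      simp only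
      rw [← this]
      refine integral_congr_ae (Filter.Eventually.of_forall fun ω => ?_)
      beta_reduce
      rw [real_inner_smul_left, real_inner_smul_left, real_inner_comm]
      congr 2
      push_cast; ring
    · refine Integrable.of_bound (C := 1) (Continuous.aestronglyMeasurable (by fun_prop)) ?_
      exact Filter.Eventually.of_forall fun p => by
        simp only [Function.uncurry, Complex.norm_exp_ofReal_mul_I, le_refl]
  have h3 : ‖σ.real Set.univ • shellKernel n z‖ ≤ C * (1 + n * ‖z‖) ^ (-β) *
      volume.real (unitShell (EuclideanSpace ℝ (Fin d)) n) := by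
    rw [← h1, h2]
    refine norm_setIntegral_le_of_norm_le_const (volume_unitShell_lt_top n) fun ξ hξ => ?_
    rw [Complex.norm_real, Real.norm_eq_abs]
    refine (hdecay _ (by positivity)).trans ?_
    gcongr C * ?_
    refine Real.rpow_le_rpow_of_nonpos (by positivity) ?_ (by linarith)
    have h4 : (n : ℝ) * ‖z‖ ≤ ‖z‖ * ‖ξ‖ := by
      rw [mul_comm]; exact mul_le_mul_of_nonneg_left hξ.1 (norm_nonneg z)
    have h5 : 1 ≤ 2 * Real.pi := by linarith [Real.pi_gt_three]
    have h6 := le_mul_of_one_le_left (by positivity : 0 ≤ ‖z‖ * ‖ξ‖) h5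
    linarith
  rw [norm_smul, Real.norm_eq_abs, abs_of_pos hm] at h3
  rw [div_mul_eq_mul_div, div_mul_eq_mul_div, le_div_iff₀ hm]
  linarith

end ShellKernel

section ShellExtension

variable {d : ℕ}

/-- The inverse Fourier transform of the restriction of `φ` to a shell. -/
noncomputable def shellExtension (n : ℕ) (φ : EuclideanSpace ℝ (Fin d) → ℂ)
    (x : EuclideanSpace ℝ (Fin d)) : ℂ :=
  ∫ ξ in unitShell (EuclideanSpace ℝ (Fin d)) n,
    φ ξ * Complex.exp ((2 * Real.pi * inner ℝ x ξ : ℝ) * Complex.I)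

theorem norm_shellExtension_le (n : ℕ) (φ : EuclideanSpace ℝ (Fin d) → ℂ)
    (x : EuclideanSpace ℝ (Fin d)) :
    ‖shellExtension n φ x‖ ≤ ∫ ξ in unitShell (EuclideanSpace ℝ (Fin d)) n, ‖φ ξ‖ := by
  refine (norm_integral_le_integral_norm _).trans_eq ?_
  simp only [norm_mul, Complex.norm_exp_ofReal_mul_I, mul_one]

theorem continuous_shellExtension {n : ℕ} {φ : EuclideanSpace ℝ (Fin d) → ℂ}
    (hφ : IntegrableOn φ (unitShell (EuclideanSpace ℝ (Fin d)) n)) :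
    Continuous (shellExtension n φ) := by
  refine continuous_of_dominated (bound := fun ξ => ‖φ ξ‖) (fun x => ?_) (fun x => ?_) hφ.norm ?_
  · exact hφ.aestronglyMeasurable.mul (Continuous.aestronglyMeasurable (by fun_prop))
  · exact Filter.Eventually.of_forall fun ξ => by
      simp only [norm_mul, Complex.norm_exp_ofReal_mul_I, mul_one, le_refl]
  · exact Filter.Eventually.of_forall fun ξ => by fun_prop

theorem continuous_shellKernel (n : ℕ) :
    Continuous (shellKernel n : EuclideanSpace ℝ (Fin d) → ℂ) := by
  have h := continuous_shellExtension (n := n) (φ := fun _ : EuclideanSpace ℝ (Fin d) => (1 : ℂ))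
    (integrable_const _)
  unfold shellExtension at h
  simp only [one_mul] at h
  exact h

theorem integral_norm_shellExtension_sq_le {μ : Measure (EuclideanSpace ℝ (Fin d))}
    [IsFiniteMeasure μ] {n : ℕ} {M : ℝ} (hM : 0 < M)
    (hK : ∀ x, ∫ y, ‖shellKernel n (x - y)‖ ∂μ ≤ M) {φ : EuclideanSpace ℝ (Fin d) → ℂ}
    (hφ : MemLp φ 2 (volume.restrict (unitShell (EuclideanSpace ℝ (Fin d)) n))) :
    ∫ x, ‖shellExtension n φ x‖ ^ 2 ∂μ ≤
      M * ∫ ξ in unitShell (EuclideanSpace ℝ (Fin d)) n, ‖φ ξ‖ ^ 2 := by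
  set ν := volume.restrict (unitShell (EuclideanSpace ℝ (Fin d)) n) with hν
  have hφ1 : Integrable φ ν := hφ.integrable (by norm_num)
  have hφ2 : Integrable (fun ξ => ‖φ ξ‖ ^ 2) ν := hφ.integrable_norm_pow two_ne_zero
  set e : EuclideanSpace ℝ (Fin d) → EuclideanSpace ℝ (Fin d) → ℂ :=
    fun x ξ => Complex.exp ((2 * Real.pi * inner ℝ x ξ : ℝ) * Complex.I) with he
  have he1 : ∀ x ξ, ‖e x ξ‖ = 1 := fun x ξ => Complex.norm_exp_ofReal_mul_I _
  have hec : Continuous fun p : EuclideanSpace ℝ (Fin d) × EuclideanSpace ℝ (Fin d) =>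
    e p.1 p.2 := by fun_prop
  set g := shellExtension n φ with hg
  have hgc : Continuous g := continuous_shellExtension hφ1
  set B := ∫ ξ, ‖φ ξ‖ ∂ν with hB
  have hgB : ∀ x, ‖g x‖ ≤ B := norm_shellExtension_le n φ
  have hB0 : 0 ≤ B := (norm_nonneg _).trans (hgB 0)
  set G : EuclideanSpace ℝ (Fin d) → ℂ := fun ξ => ∫ x, starRingEnd ℂ (g x) * e x ξ ∂μ with hG
  have hgi : Integrable (fun x => starRingEnd ℂ (g x)) μ :=
    Integrable.of_bound (Continuous.aestronglyMeasurable (by fun_prop)) B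
      (Filter.Eventually.of_forall fun x => by simpa using hgB x)
  have hg2 : Integrable (fun x => ‖g x‖ ^ 2) μ :=
    Integrable.of_bound (Continuous.aestronglyMeasurable (by fun_prop)) (B ^ 2)
      (Filter.Eventually.of_forall fun x => by
        rw [norm_pow, norm_norm]; exact pow_le_pow_left₀ (norm_nonneg _) (hgB x) 2)
  have hGc : Continuous G := by
    refine continuous_of_dominated (bound := fun x => ‖starRingEnd ℂ (g x)‖) (fun ξ => ?_)
      (fun ξ => ?_) hgi.norm ?_
    · exact Continuous.aestronglyMeasurable (by fun_prop)
    · exact Filter.Eventually.of_forall fun x => by rw [norm_mul, he1, mul_one]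
    · exact Filter.Eventually.of_forall fun x => by fun_prop
  have hGB : ∀ ξ, ‖G ξ‖ ≤ B * μ.real Set.univ := fun ξ =>
    norm_integral_le_of_norm_le_const (Filter.Eventually.of_forall fun x => by
      rw [norm_mul, he1, mul_one]; simpa using hgB x)
  have hG2 : Integrable (fun ξ => ‖G ξ‖ ^ 2) ν :=
    Integrable.of_bound (Continuous.aestronglyMeasurable (by fun_prop)) ((B * μ.real Set.univ) ^ 2)
      (Filter.Eventually.of_forall fun x => by
        rw [norm_pow, norm_norm]; exact pow_le_pow_left₀ (norm_nonneg _) (hGB x) 2)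
  have hpair : ((∫ x, ‖g x‖ ^ 2 ∂μ : ℝ) : ℂ) = ∫ ξ, φ ξ * G ξ ∂ν := by
    calc ((∫ x, ‖g x‖ ^ 2 ∂μ : ℝ) : ℂ)
        = ∫ x, ∫ ξ, starRingEnd ℂ (g x) * (φ ξ * e x ξ) ∂ν ∂μ := by
          rw [← integral_complex_ofReal]
          refine integral_congr_ae (Filter.Eventually.of_forall fun x => ?_)
          simp only
          rw [integral_const_mul, Complex.ofReal_pow, ← Complex.conj_mul']
          rfl
      _ = ∫ ξ, ∫ x, starRingEnd ℂ (g x) * (φ ξ * e x ξ) ∂μ ∂ν := by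
          refine integral_integral_swap ?_
          have h1 := hgi.mul_prod hφ1
          refine h1.mono ((hgi.aestronglyMeasurable.comp_fst).mul
            ((hφ1.aestronglyMeasurable.comp_snd).mul hec.aestronglyMeasurable)) ?_
          exact Filter.Eventually.of_forall fun p => by
            simp only [Function.uncurry, norm_mul, he1, mul_one, le_refl]
      _ = ∫ ξ, φ ξ * G ξ ∂ν := by
          refine integral_congr_ae (Filter.Eventually.of_forall fun ξ => ?_)
          simp only [hG]
          rw [← integral_const_mul]
          refine integral_congr_ae (Filter.Eventually.of_forall fun x => ?_)
          simp only; ring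
  have hGG : ∫ ξ, ‖G ξ‖ ^ 2 ∂ν ≤ M * ∫ x, ‖g x‖ ^ 2 ∂μ := by
    have hprod : ((∫ ξ, ‖G ξ‖ ^ 2 ∂ν : ℝ) : ℂ) =
        ∫ p, starRingEnd ℂ (g p.1) * g p.2 * shellKernel n (p.1 - p.2) ∂(μ.prod μ) := by
      calc ((∫ ξ, ‖G ξ‖ ^ 2 ∂ν : ℝ) : ℂ)
          = ∫ ξ, ∫ p, (starRingEnd ℂ (g p.1) * e p.1 ξ) *
              (starRingEnd ℂ (starRingEnd ℂ (g p.2) * e p.2 ξ)) ∂(μ.prod μ) ∂ν := by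
            rw [← integral_complex_ofReal]
            refine integral_congr_ae (Filter.Eventually.of_forall fun ξ => ?_)
            simp only
            rw [integral_prod_mul (fun x => starRingEnd ℂ (g x) * e x ξ)
              (fun x => starRingEnd ℂ (starRingEnd ℂ (g x) * e x ξ)), integral_conj,
              Complex.ofReal_pow, ← Complex.mul_conj']
        _ = ∫ p, ∫ ξ, (starRingEnd ℂ (g p.1) * e p.1 ξ) *
              (starRingEnd ℂ (starRingEnd ℂ (g p.2) * e p.2 ξ)) ∂ν ∂(μ.prod μ) := by
            refine integral_integral_swap (Integrable.of_bound
              (Continuous.aestronglyMeasurable (by fun_prop)) (B * B)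
              (Filter.Eventually.of_forall fun p => ?_))
            simp only [Function.uncurry, norm_mul, he1, mul_one, RCLike.norm_conj]
            exact mul_le_mul (hgB _) (hgB _) (norm_nonneg _) hB0
        _ = _ := by
            refine integral_congr_ae (Filter.Eventually.of_forall fun p => ?_)
            simp only [shellKernel]
            rw [← integral_const_mul]
            refine integral_congr_ae (Filter.Eventually.of_forall fun ξ => ?_)
            simp only [he, map_mul, Complex.conj_conj, ← Complex.exp_conj, Complex.conj_I,
              Complex.conj_ofReal]
            rw [inner_sub_left, mul_sub, Complex.ofReal_sub, sub_mul, sub_eq_add_neg,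
              Complex.exp_add, mul_neg]
            ring
    have hKB : ∀ z : EuclideanSpace ℝ (Fin d), ‖shellKernel n z‖ ≤ ν.real Set.univ := fun z => by
      have := norm_integral_le_of_norm_le_const (μ := ν) (C := 1)
        (Filter.Eventually.of_forall fun ξ => (he1 z ξ).le)
      rw [one_mul] at this
      exact this
    have hKc := continuous_shellKernel (d := d) n
    have hint : ∀ j : EuclideanSpace ℝ (Fin d) × EuclideanSpace ℝ (Fin d) →
        EuclideanSpace ℝ (Fin d), Continuous j →
        Integrable (fun p => ‖g (j p)‖ ^ 2 * ‖shellKernel n (p.1 - p.2)‖) (μ.prod μ) := by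
      intro j hj
      refine Integrable.of_bound (Continuous.aestronglyMeasurable (by fun_prop))
        (B ^ 2 * ν.real Set.univ) (Filter.Eventually.of_forall fun p => ?_)
      rw [norm_mul, norm_norm, norm_pow, norm_norm]
      exact mul_le_mul (pow_le_pow_left₀ (norm_nonneg _) (hgB _) 2) (hKB _) (norm_nonneg _)
        (by positivity)
    have hfst : ∫ p, ‖g p.1‖ ^ 2 * ‖shellKernel n (p.1 - p.2)‖ ∂(μ.prod μ) ≤
        M * ∫ x, ‖g x‖ ^ 2 ∂μ := by
      rw [integral_prod _ (hint Prod.fst continuous_fst), ← integral_const_mul]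
      refine integral_mono_of_nonneg (Filter.Eventually.of_forall fun x => by positivity)
        (hg2.const_mul M) (Filter.Eventually.of_forall fun x => ?_)
      simp only
      rw [integral_const_mul, mul_comm]
      exact mul_le_mul_of_nonneg_right (hK x) (by positivity)
    have hsnd : ∫ p, ‖g p.2‖ ^ 2 * ‖shellKernel n (p.1 - p.2)‖ ∂(μ.prod μ) ≤
        M * ∫ x, ‖g x‖ ^ 2 ∂μ := by
      refine le_trans (le_of_eq ?_) hfst
      rw [← integral_prod_swap]
      refine integral_congr_ae (Filter.Eventually.of_forall fun p => ?_)
      simp only [Prod.fst_swap, Prod.snd_swap]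
      rw [shellKernel_eq_of_norm_eq n (norm_sub_rev p.1 p.2)]
    have hle : ∫ ξ, ‖G ξ‖ ^ 2 ∂ν ≤
        ∫ p, (1 / 2) * (‖g p.1‖ ^ 2 * ‖shellKernel n (p.1 - p.2)‖ +
          ‖g p.2‖ ^ 2 * ‖shellKernel n (p.1 - p.2)‖) ∂(μ.prod μ) := by
      have h1 : ∫ ξ, ‖G ξ‖ ^ 2 ∂ν = ‖((∫ ξ, ‖G ξ‖ ^ 2 ∂ν : ℝ) : ℂ)‖ := by
        rw [Complex.norm_real, Real.norm_eq_abs, abs_of_nonneg (by positivity)]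
      rw [h1, hprod]
      refine norm_integral_le_of_norm_le
        (((hint _ continuous_fst).add (hint _ continuous_snd)).const_mul _)
        (Filter.Eventually.of_forall fun p => ?_)
      rw [norm_mul, norm_mul, RCLike.norm_conj, ← add_mul, ← mul_assoc]
      refine mul_le_mul_of_nonneg_right ?_ (norm_nonneg _)
      nlinarith [sq_nonneg (‖g p.1‖ - ‖g p.2‖)]
    rw [integral_const_mul, integral_add (hint _ continuous_fst) (hint _ continuous_snd)] at hle
    linarith
  have hmain : ∫ x, ‖g x‖ ^ 2 ∂μ ≤ ∫ ξ, (M / 2 * ‖φ ξ‖ ^ 2 + 1 / (2 * M) * ‖G ξ‖ ^ 2) ∂ν := by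
    have h1 : ∫ x, ‖g x‖ ^ 2 ∂μ = ‖((∫ x, ‖g x‖ ^ 2 ∂μ : ℝ) : ℂ)‖ := by
      rw [Complex.norm_real, Real.norm_eq_abs, abs_of_nonneg (by positivity)]
    rw [h1, hpair]
    refine norm_integral_le_of_norm_le ((hφ2.const_mul _).add (hG2.const_mul _))
      (Filter.Eventually.of_forall fun ξ => ?_)
    rw [norm_mul]
    have h2 : M / 2 * ‖φ ξ‖ ^ 2 + 1 / (2 * M) * ‖G ξ‖ ^ 2 - ‖φ ξ‖ * ‖G ξ‖ =
        (M * ‖φ ξ‖ - ‖G ξ‖) ^ 2 / (2 * M) := by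
      field_simp; ring
    have h3 : 0 ≤ (M * ‖φ ξ‖ - ‖G ξ‖) ^ 2 / (2 * M) := by positivity
    linarith
  rw [integral_add (hφ2.const_mul _) (hG2.const_mul _), integral_const_mul,
    integral_const_mul] at hmain
  have h4 : 1 / (2 * M) * ∫ ξ, ‖G ξ‖ ^ 2 ∂ν ≤ 1 / 2 * ∫ x, ‖g x‖ ^ 2 ∂μ := by
    refine (mul_le_mul_of_nonneg_left hGG (by positivity)).trans_eq ?_
    field_simp
  linarith

end ShellExtension

theorem exists_integral_norm_shellKernel_le {d : ℕ}
    {σ μ : Measure (EuclideanSpace ℝ (Fin (d + 1)))} [IsFiniteMeasure σ] [IsFiniteMeasure μ]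
    (hσ : IsRotationInvariant σ) (hσ0 : σ ≠ 0) (i : Fin (d + 1)) {α β C C' : ℝ} (hαβ : α < β)
    (hβ : 0 ≤ β) (hC' : 0 ≤ C')
    (hdecay : ∀ t, 0 ≤ t → |sphereProfile σ i t| ≤ C' * (1 + t) ^ (-β))
    (hfrost : ∀ (x : EuclideanSpace ℝ (Fin (d + 1))) (δ : ℝ), 0 < δ →
      μ (ball x δ) ≤ ENNReal.ofReal (C * δ ^ α)) :
    ∃ A : ℝ, 0 < A ∧ ∀ n : ℕ, 0 < n → ∀ x,
      ∫ y, ‖(shellKernel n (x - y) : ℂ)‖ ∂μ ≤ A * (n : ℝ) ^ ((d : ℝ) - α) := by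
  obtain ⟨A, hA0, hA⟩ := lintegral_one_add_mul_dist_rpow_le hαβ hβ hfrost
  obtain ⟨V, hV0, hV⟩ := exists_volume_unitShell_le d
  refine ⟨C' / σ.real Set.univ * (V * 2 ^ d) * A + 1, by positivity, fun n hn x => ?_⟩
  have hn' : (1 : ℝ) ≤ n := by exact_mod_cast hn
  have hvol : volume.real (unitShell (EuclideanSpace ℝ (Fin (d + 1))) n) ≤
      V * 2 ^ d * (n : ℝ) ^ d := by
    refine (ENNReal.toReal_le_of_le_ofReal (by positivity) (hV n)).trans ?_
    rw [mul_assoc, ← mul_pow]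
    gcongr
    linarith
  have hint : ∫ y, (1 + (n : ℝ) * ‖x - y‖) ^ (-β) ∂μ ≤ A * (n : ℝ) ^ (-α) := by
    rw [integral_eq_lintegral_of_nonneg_ae
      (Filter.Eventually.of_forall fun y => by positivity)
      (Measurable.aestronglyMeasurable (by fun_prop))]
    refine ENNReal.toReal_le_of_le_ofReal (by positivity) ?_
    simpa only [dist_eq_norm] using hA x n (by positivity)
  have hint' : Integrable (fun y => (1 + (n : ℝ) * ‖x - y‖) ^ (-β)) μ := by
    refine Integrable.of_bound (Measurable.aestronglyMeasurable (by fun_prop)) 1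
      (Filter.Eventually.of_forall fun y => ?_)
    rw [Real.norm_of_nonneg (by positivity)]
    exact Real.rpow_le_one_of_one_le_of_nonpos (by nlinarith [norm_nonneg (x - y)]) (by linarith)
  calc ∫ y, ‖(shellKernel n (x - y) : ℂ)‖ ∂μ
      ≤ ∫ y, C' / σ.real Set.univ * (V * 2 ^ d * (n : ℝ) ^ d) *
          (1 + (n : ℝ) * ‖x - y‖) ^ (-β) ∂μ := by
        refine integral_mono_of_nonneg (Filter.Eventually.of_forall fun y => norm_nonneg _)
          (hint'.const_mul _) (Filter.Eventually.of_forall fun y => ?_)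
        refine (hσ.norm_shellKernel_le hσ0 i hβ hC' hdecay n (x - y)).trans ?_
        exact mul_le_mul_of_nonneg_right (mul_le_mul_of_nonneg_left hvol (by positivity))
          (by positivity)
    _ ≤ C' / σ.real Set.univ * (V * 2 ^ d * (n : ℝ) ^ d) * (A * (n : ℝ) ^ (-α)) := by
        rw [integral_const_mul]
        gcongr
    _ = C' / σ.real Set.univ * (V * 2 ^ d) * A * (n : ℝ) ^ ((d : ℝ) - α) := by
        rw [sub_eq_add_neg, Real.rpow_add (by positivity), Real.rpow_natCast]
        ring
    _ ≤ _ := by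
        gcongr
        linarith

theorem sq_integral_le_mul_integral_sq {Ω : Type*} [MeasurableSpace Ω] {μ : Measure Ω}
    [IsFiniteMeasure μ] {f : Ω → ℝ} (hf : MemLp f 2 μ) :
    (∫ x, f x ∂μ) ^ 2 ≤ μ.real Set.univ * ∫ x, f x ^ 2 ∂μ := by
  have h1 : Integrable f μ := hf.integrable (by norm_num)
  have h2 : Integrable (fun x => f x ^ 2) μ := hf.integrable_sq
  set m := μ.real Set.univ with hm
  set t := ∫ x, f x ∂μ with ht
  have h0 : 0 ≤ ∫ x, (m * f x - t) ^ 2 ∂μ := integral_nonneg fun x => sq_nonneg _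
  have h3 : ∫ x, (m * f x - t) ^ 2 ∂μ = m * (m * ∫ x, f x ^ 2 ∂μ - t ^ 2) := by
    calc ∫ x, (m * f x - t) ^ 2 ∂μ
        = ∫ x, (m ^ 2 * f x ^ 2 - 2 * m * t * f x + t ^ 2) ∂μ := by congr with x; ring
      _ = m ^ 2 * ∫ x, f x ^ 2 ∂μ - 2 * m * t * t + m * t ^ 2 := by
          rw [integral_add (f := fun x => m ^ 2 * f x ^ 2 - 2 * m * t * f x)
            ((h2.const_mul _).sub (h1.const_mul _)) (integrable_const _),
            integral_sub (h2.const_mul _) (h1.const_mul _), integral_const_mul, integral_const_mul,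
            integral_const, smul_eq_mul]
      _ = _ := by ring
  rcases (measureReal_nonneg : 0 ≤ m).eq_or_lt with hm0 | hm0
  · have : μ = 0 := by
      rw [← Measure.measure_univ_eq_zero]
      exact (measureReal_eq_zero_iff).mp hm0.symm
    simp [ht, this]
  · rw [h3] at h0
    linarith [nonneg_of_mul_nonneg_right h0 hm0]

section ShellMaximal

variable {d : ℕ}

theorem measurable_shellExtension_mul {n : ℕ} {F : EuclideanSpace ℝ (Fin d) → ℂ}
    (hF : Measurable F) {k : ℝ → ℝ → ℂ} (hk : Measurable (Function.uncurry k)) :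
    Measurable fun p : ℝ × EuclideanSpace ℝ (Fin d) =>
      shellExtension n (fun ξ => F ξ * k p.1 ‖ξ‖) p.2 := by
  unfold shellExtension
  refine (StronglyMeasurable.integral_prod_right (f := fun (p : ℝ × EuclideanSpace ℝ (Fin d)) ξ =>
    F ξ * k p.1 ‖ξ‖ * Complex.exp ((2 * Real.pi * inner ℝ p.2 ξ : ℝ) * Complex.I))
    ?_).measurable
  refine Measurable.stronglyMeasurable ?_
  have h1 : Measurable fun q : (ℝ × EuclideanSpace ℝ (Fin d)) × EuclideanSpace ℝ (Fin d) =>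
      k q.1.1 ‖q.2‖ := hk.comp (by fun_prop : Measurable
        fun q : (ℝ × EuclideanSpace ℝ (Fin d)) × EuclideanSpace ℝ (Fin d) => (q.1.1, ‖q.2‖))
  have h2 : Measurable fun q : (ℝ × EuclideanSpace ℝ (Fin d)) × EuclideanSpace ℝ (Fin d) =>
      Complex.exp ((2 * Real.pi * inner ℝ q.1.2 q.2 : ℝ) * Complex.I) :=
    Continuous.measurable (by fun_prop)
  exact ((hF.comp measurable_snd).mul h1).mul h2

theorem memLp_mul_comp_norm {n : ℕ} {F : EuclideanSpace ℝ (Fin d) → ℂ}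
    (hFm : Measurable F)
    (hF : MemLp F 2 (volume.restrict (unitShell (EuclideanSpace ℝ (Fin d)) n)))
    {D : ℝ} {κ : ℝ → ℂ} (hκ : Measurable κ) (hκD : ∀ s ∈ Set.Ico (n : ℝ) (n + 1), ‖κ s‖ ≤ D) :
    MemLp (fun ξ => F ξ * κ ‖ξ‖) 2 (volume.restrict (unitShell (EuclideanSpace ℝ (Fin d)) n)) ∧
      ∀ᵐ ξ ∂(volume.restrict (unitShell (EuclideanSpace ℝ (Fin d)) n)),
        ‖F ξ * κ ‖ξ‖‖ ≤ D * ‖F ξ‖ := by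
  have hle : ∀ᵐ ξ ∂(volume.restrict (unitShell (EuclideanSpace ℝ (Fin d)) n)),
      ‖F ξ * κ ‖ξ‖‖ ≤ D * ‖F ξ‖ :=
    (ae_restrict_mem (measurableSet_unitShell n)).mono fun ξ hξ => by
      rw [norm_mul, mul_comm]
      exact mul_le_mul_of_nonneg_right (hκD _ hξ) (norm_nonneg _)
  exact ⟨hF.of_le_mul (hFm.mul (hκ.comp measurable_norm)).aestronglyMeasurable hle, hle⟩

theorem norm_shellExtension_mul_le {n : ℕ} {F : EuclideanSpace ℝ (Fin d) → ℂ}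
    (hFm : Measurable F)
    (hF : MemLp F 2 (volume.restrict (unitShell (EuclideanSpace ℝ (Fin d)) n)))
    {D : ℝ} {κ : ℝ → ℂ} (hκ : Measurable κ) (hκD : ∀ s ∈ Set.Ico (n : ℝ) (n + 1), ‖κ s‖ ≤ D)
    (x : EuclideanSpace ℝ (Fin d)) :
    ‖shellExtension n (fun ξ => F ξ * κ ‖ξ‖) x‖ ≤
      D * ∫ ξ in unitShell (EuclideanSpace ℝ (Fin d)) n, ‖F ξ‖ := by
  obtain ⟨hLp, hle⟩ := memLp_mul_comp_norm hFm hF hκ hκD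
  refine (norm_shellExtension_le n _ x).trans ?_
  rw [← integral_const_mul]
  exact integral_mono_ae (hLp.integrable (by norm_num)).norm
    ((hF.integrable (by norm_num)).norm.const_mul _) hle

theorem integral_norm_shellExtension_mul_sq_le {μ : Measure (EuclideanSpace ℝ (Fin d))}
    [IsFiniteMeasure μ] {n : ℕ} {M : ℝ} (hM : 0 < M)
    (hK : ∀ x, ∫ y, ‖shellKernel n (x - y)‖ ∂μ ≤ M) {F : EuclideanSpace ℝ (Fin d) → ℂ}
    (hFm : Measurable F)
    (hF : MemLp F 2 (volume.restrict (unitShell (EuclideanSpace ℝ (Fin d)) n)))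
    {D : ℝ} {κ : ℝ → ℂ} (hκ : Measurable κ) (hκD : ∀ s ∈ Set.Ico (n : ℝ) (n + 1), ‖κ s‖ ≤ D) :
    ∫ x, ‖shellExtension n (fun ξ => F ξ * κ ‖ξ‖) x‖ ^ 2 ∂μ ≤
      M * (D ^ 2 * ∫ ξ in unitShell (EuclideanSpace ℝ (Fin d)) n, ‖F ξ‖ ^ 2) := by
  obtain ⟨hLp, hle⟩ := memLp_mul_comp_norm hFm hF hκ hκD
  refine (integral_norm_shellExtension_sq_le hM hK hLp).trans ?_
  gcongr
  rw [← integral_const_mul]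
  refine integral_mono_ae (hLp.integrable_norm_pow two_ne_zero)
    ((hF.integrable_norm_pow two_ne_zero).const_mul _) (hle.mono fun ξ hξ => ?_)
  simp only [← mul_pow]
  gcongr

theorem shellExtension_eq_add_integral {n : ℕ} {F : EuclideanSpace ℝ (Fin d) → ℂ}
    (hFm : Measurable F)
    (hF : MemLp F 2 (volume.restrict (unitShell (EuclideanSpace ℝ (Fin d)) n)))
    {a r D : ℝ} (har : a ≤ r) {k k' : ℝ → ℝ → ℂ}
    (hk : Measurable (Function.uncurry k)) (hk' : Measurable (Function.uncurry k'))
    (hderiv : ∀ ρ ∈ Set.Icc a r, ∀ s ∈ Set.Ico (n : ℝ) (n + 1),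
      HasDerivAt (fun ρ => k ρ s) (k' ρ s) ρ)
    (hkD : ∀ ρ ∈ Set.Icc a r, ∀ s ∈ Set.Ico (n : ℝ) (n + 1), ‖k ρ s‖ ≤ D)
    (hkD' : ∀ ρ ∈ Set.Icc a r, ∀ s ∈ Set.Ico (n : ℝ) (n + 1), ‖k' ρ s‖ ≤ D)
    (x : EuclideanSpace ℝ (Fin d)) :
    shellExtension n (fun ξ => F ξ * k r ‖ξ‖) x =
      shellExtension n (fun ξ => F ξ * k a ‖ξ‖) x +
        ∫ ρ in Set.Ioc a r, shellExtension n (fun ξ => F ξ * k' ρ ‖ξ‖) x := by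
  set ν := volume.restrict (unitShell (EuclideanSpace ℝ (Fin d)) n) with hν
  have hmem : ∀ᵐ ξ ∂ν, ‖ξ‖ ∈ Set.Ico (n : ℝ) (n + 1) := ae_restrict_mem (measurableSet_unitShell n)
  have hF1 : Integrable F ν := hF.integrable (by norm_num)
  have hprod : Integrable (Function.uncurry fun (ρ : ℝ) (ξ : EuclideanSpace ℝ (Fin d)) =>
      F ξ * k' ρ ‖ξ‖ * Complex.exp ((2 * Real.pi * inner ℝ x ξ : ℝ) * Complex.I))
      ((volume.restrict (Set.Ioc a r)).prod ν) := by
    have hdom : Integrable (fun p : ℝ × EuclideanSpace ℝ (Fin d) => (D : ℝ) * ‖F p.2‖)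
        ((volume.restrict (Set.Ioc a r)).prod ν) := (integrable_const D).mul_prod hF1.norm
    refine hdom.mono' (Measurable.aestronglyMeasurable ?_) ?_
    · have h1 : Measurable fun q : ℝ × EuclideanSpace ℝ (Fin d) => k' q.1 ‖q.2‖ :=
        hk'.comp (by fun_prop : Measurable
          fun q : ℝ × EuclideanSpace ℝ (Fin d) => (q.1, ‖q.2‖))
      have h2 : Measurable fun q : ℝ × EuclideanSpace ℝ (Fin d) =>
          Complex.exp ((2 * Real.pi * inner ℝ x q.2 : ℝ) * Complex.I) :=
        Continuous.measurable (by fun_prop)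
      exact ((hFm.comp measurable_snd).mul h1).mul h2
    · have h1 : ∀ᵐ p ∂((volume.restrict (Set.Ioc a r)).prod ν), p.1 ∈ Set.Ioc a r :=
        Measure.quasiMeasurePreserving_fst.ae (ae_restrict_mem measurableSet_Ioc)
      have h2 : ∀ᵐ p ∂((volume.restrict (Set.Ioc a r)).prod ν),
          ‖p.2‖ ∈ Set.Ico (n : ℝ) (n + 1) := Measure.quasiMeasurePreserving_snd.ae hmem
      filter_upwards [h1, h2] with p hp1 hp2
      simp only [Function.uncurry, norm_mul, Complex.norm_exp_ofReal_mul_I, mul_one]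
      rw [mul_comm]
      exact mul_le_mul_of_nonneg_right (hkD' _ (Set.Ioc_subset_Icc_self hp1) _ hp2) (norm_nonneg _)
  have hi : ∀ ρ ∈ Set.Icc a r, Integrable (fun ξ => F ξ * k ρ ‖ξ‖ *
      Complex.exp ((2 * Real.pi * inner ℝ x ξ : ℝ) * Complex.I)) ν := fun ρ hρ =>
    ((memLp_mul_comp_norm hFm hF hk.of_uncurry_left (hkD ρ hρ)).1.integrable
      (by norm_num)).mul_bdd (c := 1) (Continuous.aestronglyMeasurable (by fun_prop))
      (Filter.Eventually.of_forall fun ξ => (Complex.norm_exp_ofReal_mul_I _).le)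
  rw [← sub_eq_iff_eq_add']
  unfold shellExtension
  rw [integral_integral_swap hprod, ← integral_sub (hi r ⟨har, le_rfl⟩) (hi a ⟨le_rfl, har⟩)]
  refine integral_congr_ae (hmem.mono fun ξ hξ => ?_)
  simp only
  rw [integral_mul_const, integral_const_mul, ← intervalIntegral.integral_of_le har,
    intervalIntegral.integral_eq_sub_of_hasDerivAt (f := fun ρ => k ρ ‖ξ‖)]
  · ring
  · intro ρ hρ
    rw [Set.uIcc_of_le har] at hρ
    exact hderiv ρ hρ _ hξ
  · rw [intervalIntegrable_iff_integrableOn_Ioc_of_le har]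
    exact Integrable.of_bound hk'.of_uncurry_right.aestronglyMeasurable D
      ((ae_restrict_mem measurableSet_Ioc).mono fun ρ hρ =>
        hkD' _ (Set.Ioc_subset_Icc_self hρ) _ hξ)

theorem exists_shellExtension_maximal {μ : Measure (EuclideanSpace ℝ (Fin d))}
    [IsFiniteMeasure μ] {n : ℕ} {M : ℝ} (hM : 0 < M)
    (hK : ∀ x, ∫ y, ‖shellKernel n (x - y)‖ ∂μ ≤ M) {F : EuclideanSpace ℝ (Fin d) → ℂ}
    (hFm : Measurable F)
    (hF : MemLp F 2 (volume.restrict (unitShell (EuclideanSpace ℝ (Fin d)) n)))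
    {a b D : ℝ} (hab : a ≤ b) {k k' : ℝ → ℝ → ℂ}
    (hk : Measurable (Function.uncurry k)) (hk' : Measurable (Function.uncurry k'))
    (hderiv : ∀ r ∈ Set.Icc a b, ∀ s ∈ Set.Ico (n : ℝ) (n + 1),
      HasDerivAt (fun r => k r s) (k' r s) r)
    (hkD : ∀ r ∈ Set.Icc a b, ∀ s ∈ Set.Ico (n : ℝ) (n + 1), ‖k r s‖ ≤ D)
    (hkD' : ∀ r ∈ Set.Icc a b, ∀ s ∈ Set.Ico (n : ℝ) (n + 1), ‖k' r s‖ ≤ D) :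
    ∃ H : EuclideanSpace ℝ (Fin d) → ℝ, Measurable H ∧ (∀ x, 0 ≤ H x) ∧
      (∀ x, ∀ r ∈ Set.Icc a b, ‖shellExtension n (fun ξ => F ξ * k r ‖ξ‖) x‖ ≤ H x) ∧
      ∫⁻ x, ENNReal.ofReal (H x ^ 2) ∂μ ≤ ENNReal.ofReal (2 * (1 + (b - a) ^ 2) * M * D ^ 2 *
        ∫ ξ in unitShell (EuclideanSpace ℝ (Fin d)) n, ‖F ξ‖ ^ 2) := by
  set I := ∫ ξ in unitShell (EuclideanSpace ℝ (Fin d)) n, ‖F ξ‖ ^ 2 with hI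
  set J := D * ∫ ξ in unitShell (EuclideanSpace ℝ (Fin d)) n, ‖F ξ‖ with hJ
  have ha : a ∈ Set.Icc a b := ⟨le_rfl, hab⟩
  set τ := (volume : Measure ℝ).restrict (Set.Ioc a b) with hτ
  have hτmem : ∀ᵐ ρ ∂τ, ρ ∈ Set.Icc a b :=
    (ae_restrict_mem measurableSet_Ioc).mono fun ρ hρ => Set.Ioc_subset_Icc_self hρ
  obtain ⟨P, hP⟩ : ∃ P : ℝ → EuclideanSpace ℝ (Fin d) → ℝ,
      ∀ ρ x, P ρ x = ‖shellExtension n (fun ξ => F ξ * k' ρ ‖ξ‖) x‖ := ⟨_, fun _ _ => rfl⟩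
  obtain ⟨Q, hQ⟩ : ∃ Q : EuclideanSpace ℝ (Fin d) → ℝ,
      ∀ x, Q x = ‖shellExtension n (fun ξ => F ξ * k a ‖ξ‖) x‖ := ⟨_, fun _ => rfl⟩
  have hPm : Measurable fun p : ℝ × EuclideanSpace ℝ (Fin d) => P p.1 p.2 := by
    simp only [hP]
    exact (measurable_shellExtension_mul hFm hk').norm
  have hPJ : ∀ ρ ∈ Set.Icc a b, ∀ x, ‖P ρ x‖ ≤ J := fun ρ hρ x => by
    rw [hP, norm_norm]
    exact norm_shellExtension_mul_le hFm hF hk'.of_uncurry_left (hkD' ρ hρ) x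
  have hP0 : ∀ ρ x, 0 ≤ P ρ x := fun ρ x => by rw [hP]; exact norm_nonneg _
  have hPLp : ∀ x, MemLp (fun ρ => P ρ x) 2 τ := fun x =>
    MemLp.of_bound (hPm.comp (by fun_prop : Measurable fun ρ : ℝ => (ρ, x))).aestronglyMeasurable J
      (hτmem.mono fun ρ hρ => hPJ ρ hρ x)
  have hQm : Measurable Q := by
    simp only [funext hQ]
    exact (continuous_shellExtension ((memLp_mul_comp_norm hFm hF hk.of_uncurry_left
      (hkD a ha)).1.integrable (by norm_num))).norm.measurable
  have hQJ : ∀ x, ‖Q x‖ ≤ J := fun x => by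
    rw [hQ, norm_norm]
    exact norm_shellExtension_mul_le hFm hF hk.of_uncurry_left (hkD a ha) x
  have hswap : Measurable fun p : EuclideanSpace ℝ (Fin d) × ℝ => P p.2 p.1 :=
    hPm.comp measurable_swap
  have hRm : Measurable fun x => ∫ ρ, P ρ x ∂τ :=
    (StronglyMeasurable.integral_prod_right (f := fun x ρ => P ρ x)
      hswap.stronglyMeasurable).measurable
  have hQ0 : ∀ x, 0 ≤ Q x := fun x => by rw [hQ]; exact norm_nonneg _
  refine ⟨fun x => Q x + ∫ ρ, P ρ x ∂τ, hQm.add hRm,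
    fun x => add_nonneg (hQ0 x) (integral_nonneg fun ρ => hP0 ρ x), fun x r hr => ?_, ?_⟩
  · have hsub : Set.Icc a r ⊆ Set.Icc a b := Set.Icc_subset_Icc_right hr.2
    rw [shellExtension_eq_add_integral hFm hF hr.1 hk hk' (fun ρ hρ => hderiv ρ (hsub hρ))
      (fun ρ hρ => hkD ρ (hsub hρ)) (fun ρ hρ => hkD' ρ (hsub hρ)) x]
    refine (norm_add_le _ _).trans (add_le_add (hQ x).ge ?_)
    refine (norm_integral_le_integral_norm _).trans ?_
    simp only [← hP]
    exact setIntegral_mono_set ((hPLp x).integrable (by norm_num))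
      (Filter.Eventually.of_forall fun ρ => hP0 ρ x)
      (Set.Ioc_subset_Ioc_right hr.2).eventuallyLE
  · have hL : τ.real Set.univ = b - a := by
      simp [hτ, measureReal_def, hab]
    have hP2 : Integrable (fun p : EuclideanSpace ℝ (Fin d) × ℝ => P p.2 p.1 ^ 2) (μ.prod τ) := by
      refine Integrable.of_bound (hswap.pow_const 2).aestronglyMeasurable (J ^ 2) ?_
      have h1 : ∀ᵐ p ∂(μ.prod τ), p.2 ∈ Set.Icc a b :=
        Measure.quasiMeasurePreserving_snd.ae hτmem
      filter_upwards [h1] with p hp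
      rw [norm_pow]
      exact pow_le_pow_left₀ (norm_nonneg _) (hPJ _ hp _) 2
    have hQ2 : Integrable (fun x => Q x ^ 2) μ := by
      refine Integrable.of_bound (hQm.pow_const 2).aestronglyMeasurable (J ^ 2)
        (Filter.Eventually.of_forall fun x => ?_)
      rw [norm_pow]
      exact pow_le_pow_left₀ (norm_nonneg _) (hQJ x) 2
    have hint := (hQ2.const_mul 2).add (hP2.integral_prod_left.const_mul (2 * (b - a)))
    calc ∫⁻ x, ENNReal.ofReal ((Q x + ∫ ρ, P ρ x ∂τ) ^ 2) ∂μ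
        ≤ ∫⁻ x, ENNReal.ofReal (2 * Q x ^ 2 + 2 * (b - a) * ∫ ρ, P ρ x ^ 2 ∂τ) ∂μ := by
          refine lintegral_mono fun x => ENNReal.ofReal_le_ofReal ?_
          have h1 := sq_integral_le_mul_integral_sq (hPLp x)
          rw [hL] at h1
          nlinarith [sq_nonneg (Q x - ∫ ρ, P ρ x ∂τ)]
      _ = ENNReal.ofReal (∫ x, (2 * Q x ^ 2 + 2 * (b - a) * ∫ ρ, P ρ x ^ 2 ∂τ) ∂μ) := by
          refine (ofReal_integral_eq_lintegral_ofReal hint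
            (Filter.Eventually.of_forall fun x => ?_)).symm
          have : 0 ≤ b - a := by linarith
          simp only [Pi.zero_apply, Pi.add_apply]
          positivity
      _ ≤ _ := by
          refine ENNReal.ofReal_le_ofReal ?_
          rw [integral_add (hQ2.const_mul 2) (hP2.integral_prod_left.const_mul (2 * (b - a))),
            integral_const_mul, integral_const_mul,
            integral_integral_swap hP2]
          have h1 : ∫ x, Q x ^ 2 ∂μ ≤ M * (D ^ 2 * I) := by
            simp only [hQ]
            exact integral_norm_shellExtension_mul_sq_le hM hK hFm hF hk.of_uncurry_left (hkD a ha)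
          have h2 : ∫ ρ, ∫ x, P ρ x ^ 2 ∂μ ∂τ ≤ (b - a) * (M * (D ^ 2 * I)) := by
            have h3 : ∫ ρ, ∫ x, P ρ x ^ 2 ∂μ ∂τ ≤ ∫ ρ, (M * (D ^ 2 * I)) ∂τ := by
              refine integral_mono_ae hP2.integral_prod_right (integrable_const _)
                (hτmem.mono fun ρ hρ => ?_)
              simp only [hP]
              exact integral_norm_shellExtension_mul_sq_le hM hK hFm hF hk'.of_uncurry_left
                (hkD' ρ hρ)
            rwa [integral_const, hL, smul_eq_mul] at h3
          have h4 := mul_le_mul_of_nonneg_left h2 (by linarith : 0 ≤ 2 * (b - a))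
          calc _ ≤ 2 * (M * (D ^ 2 * I)) + 2 * (b - a) * ((b - a) * (M * (D ^ 2 * I))) := by
                linarith
            _ = _ := by ring

end ShellMaximal

section HalfWave

/-- For a solution `u` of a Bessel equation with `β = k / 2`, this combination of `u` and `u'`
oscillates like `exp (i ς t)`. -/
noncomputable def halfWave (u u' : ℝ → ℝ) (β ς t : ℝ) : ℂ :=
  u' t + (β / t + ς * Complex.I) * u t

variable {u u' : ℝ → ℝ} {β : ℝ}

theorem halfWave_one_sub_halfWave_neg_one (u u' : ℝ → ℝ) (β t : ℝ) :
    halfWave u u' β 1 t - halfWave u u' β (-1) t = 2 * Complex.I * u t := by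
  simp only [halfWave]
  push_cast
  ring

theorem hasDerivAt_halfWave {ς t : ℝ} (hς : ς ^ 2 = 1) (ht : t ≠ 0)
    (hu : HasDerivAt u (u' t) t) (hu' : HasDerivAt u' (-u t - 2 * β / t * u' t) t) :
    HasDerivAt (halfWave u u' β ς)
      (ς * Complex.I * halfWave u u' β ς t - β / t * halfWave u u' β ς t +
        (β ^ 2 - β) / t ^ 2 * u t) t := by
  have h1 : HasDerivAt (fun t : ℝ => ((β / t : ℝ) : ℂ) + ς * Complex.I)
      ((-β / t ^ 2 : ℝ) : ℂ) t := by
    have h := ((hasDerivAt_const t β).div (hasDerivAt_id t) ht).ofReal_comp.add_const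
      ((ς : ℂ) * Complex.I)
    exact h.congr_deriv (by simp)
  have h2 := hu'.ofReal_comp.add (h1.mul hu.ofReal_comp)
  have h3 : HasDerivAt (halfWave u u' β ς) _ t := h2.congr_of_eventuallyEq
    (Filter.Eventually.of_forall fun s => by simp [halfWave])
  refine h3.congr_deriv ?_
  have ht' : (t : ℂ) ≠ 0 := by exact_mod_cast ht
  have hς' : (ς : ℂ) ^ 2 = 1 := by exact_mod_cast hς
  simp only [halfWave]
  push_cast
  field_simp
  have hI := Complex.I_sq
  linear_combination (-(t : ℂ) ^ 2 * u t * Complex.I ^ 2) * hς' - (t : ℂ) ^ 2 * u t * hI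

theorem norm_halfWave_le {ς t t₀ B : ℝ} (hς : |ς| = 1) (hβ : 0 ≤ β) (ht₀ : 0 < t₀) (ht : t₀ ≤ t)
    (hu : |u t| ≤ B) (hu' : |u' t| ≤ B) : ‖halfWave u u' β ς t‖ ≤ (2 + β / t₀) * B := by
  have ht' : 0 < t := ht₀.trans_le ht
  have h1 : ‖(β / t : ℂ) + ς * Complex.I‖ ≤ β / t₀ + 1 := by
    refine (norm_add_le _ _).trans (add_le_add ?_ (by simp [hς]))
    rw [← Complex.ofReal_div, Complex.norm_real, Real.norm_of_nonneg (by positivity)]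
    gcongr
  calc ‖halfWave u u' β ς t‖ ≤ |u' t| + ‖(β / t : ℂ) + ς * Complex.I‖ * |u t| := by
        refine (norm_add_le _ _).trans_eq ?_
        rw [norm_mul, Complex.norm_real, Complex.norm_real, Real.norm_eq_abs, Real.norm_eq_abs]
    _ ≤ B + (β / t₀ + 1) * B := by gcongr
    _ = _ := by ring

/-- A half wave at radius `r` and frequency `s` with the oscillation at frequency `N` removed. -/
noncomputable def demodulatedWave (u u' : ℝ → ℝ) (β ς N r s : ℝ) : ℂ :=
  Complex.exp ((-(ς * (2 * Real.pi * N)) * r : ℝ) * Complex.I) *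
    halfWave u u' β ς (2 * Real.pi * r * s)

/-- The derivative of `demodulatedWave` in the radius. -/
noncomputable def demodulatedWaveDeriv (u u' : ℝ → ℝ) (β ς N r s : ℝ) : ℂ :=
  Complex.exp ((-(ς * (2 * Real.pi * N)) * r : ℝ) * Complex.I) *
    ((2 * Real.pi * ς * (s - N) * Complex.I - β / r) * halfWave u u' β ς (2 * Real.pi * r * s) +
      (β ^ 2 - β) / (r * (2 * Real.pi * r * s)) * u (2 * Real.pi * r * s))

theorem measurable_demodulatedWave (hu : Measurable u) (hu' : Measurable u') (ς N : ℝ) :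
    Measurable (Function.uncurry (demodulatedWave u u' β ς N)) := by
  unfold demodulatedWave halfWave Function.uncurry
  fun_prop

theorem measurable_demodulatedWaveDeriv (hu : Measurable u) (hu' : Measurable u') (ς N : ℝ) :
    Measurable (Function.uncurry (demodulatedWaveDeriv u u' β ς N)) := by
  unfold demodulatedWaveDeriv halfWave Function.uncurry
  fun_prop

theorem hasDerivAt_demodulatedWave (hu : ∀ t, 0 < t → HasDerivAt u (u' t) t)
    (hu' : ∀ t, 0 < t → HasDerivAt u' (-u t - 2 * β / t * u' t) t) {ς N r s : ℝ} (hς : ς ^ 2 = 1)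
    (hr : 0 < r) (hs : 0 < s) :
    HasDerivAt (fun r => demodulatedWave u u' β ς N r s)
      (demodulatedWaveDeriv u u' β ς N r s) r := by
  have ht : 0 < 2 * Real.pi * r * s := by positivity
  have h1 : HasDerivAt (fun r : ℝ => 2 * Real.pi * r * s) (2 * Real.pi * s) r :=
    (((hasDerivAt_id r).const_mul (2 * Real.pi)).mul_const s).congr_deriv (by ring)
  have h2 := (hasDerivAt_halfWave hς ht.ne' (hu _ ht) (hu' _ ht)).scomp r h1
  have h3 : HasDerivAt (fun r : ℝ => ((-(ς * (2 * Real.pi * N)) * r : ℝ) : ℂ) * Complex.I)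
      ((-(ς * (2 * Real.pi * N)) : ℝ) * Complex.I) r :=
    (((hasDerivAt_id r).const_mul (-(ς * (2 * Real.pi * N)))).ofReal_comp.mul_const
      Complex.I).congr_deriv (by simp)
  refine (h3.cexp.mul h2).congr_deriv ?_
  have hr' : (r : ℂ) ≠ 0 := by exact_mod_cast hr.ne'
  have hs' : (s : ℂ) ≠ 0 := by exact_mod_cast hs.ne'
  have hπ : (Real.pi : ℂ) ≠ 0 := by exact_mod_cast Real.pi_ne_zero
  simp only [demodulatedWaveDeriv, Function.comp_apply, Complex.real_smul]
  push_cast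
  field_simp
  ring

theorem norm_demodulatedWave_le {ς N r s t₀ B : ℝ} (hς : |ς| = 1) (hβ : 0 ≤ β) (ht₀ : 0 < t₀)
    (ht : t₀ ≤ 2 * Real.pi * r * s) (hu : |u (2 * Real.pi * r * s)| ≤ B)
    (hu' : |u' (2 * Real.pi * r * s)| ≤ B) :
    ‖demodulatedWave u u' β ς N r s‖ ≤ (2 + β / t₀) * B := by
  rw [demodulatedWave, norm_mul, Complex.norm_exp_ofReal_mul_I, one_mul]
  exact norm_halfWave_le hς hβ ht₀ ht hu hu'

theorem norm_demodulatedWaveDeriv_le {ς N r s r₀ t₀ B : ℝ} (hς : |ς| = 1) (hβ : 0 ≤ β)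
    (hr₀ : 0 < r₀) (hr : r₀ ≤ r) (ht₀ : 0 < t₀) (ht : t₀ ≤ 2 * Real.pi * r * s)
    (hs : |s - N| ≤ 1) (hu : |u (2 * Real.pi * r * s)| ≤ B)
    (hu' : |u' (2 * Real.pi * r * s)| ≤ B) :
    ‖demodulatedWaveDeriv u u' β ς N r s‖ ≤
      ((2 * Real.pi + β / r₀) * (2 + β / t₀) + |β ^ 2 - β| / (r₀ * t₀)) * B := by
  have hB : 0 ≤ B := (abs_nonneg _).trans hu
  have hr' : 0 < r := hr₀.trans_le hr
  have h1 : ‖(2 * Real.pi * ς * (s - N) * Complex.I - β / r : ℂ)‖ ≤ 2 * Real.pi + β / r₀ := by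
    refine (norm_sub_le _ _).trans (add_le_add ?_ ?_)
    · rw [show (2 * Real.pi * ς * (s - N) * Complex.I : ℂ) =
        ((2 * Real.pi * ς * (s - N) : ℝ) : ℂ) * Complex.I by push_cast; ring, norm_mul,
        Complex.norm_I, mul_one, Complex.norm_real, Real.norm_eq_abs, abs_mul, abs_mul, hς, mul_one,
        abs_of_pos Real.two_pi_pos]
      exact mul_le_of_le_one_right Real.two_pi_pos.le hs
    · rw [← Complex.ofReal_div, Complex.norm_real, Real.norm_of_nonneg (by positivity)]
      gcongr
  have h2 : ‖((β ^ 2 - β) / (r * (2 * Real.pi * r * s)) : ℂ)‖ ≤ |β ^ 2 - β| / (r₀ * t₀) := by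
    rw [show ((β ^ 2 - β) / (r * (2 * Real.pi * r * s)) : ℂ) =
      (((β ^ 2 - β) / (r * (2 * Real.pi * r * s)) : ℝ) : ℂ) by push_cast; ring,
      Complex.norm_real, Real.norm_eq_abs, abs_div]
    refine div_le_div_of_nonneg_left (abs_nonneg _) (by positivity) ?_
    refine le_trans ?_ (le_abs_self _)
    gcongr
  rw [demodulatedWaveDeriv, norm_mul, Complex.norm_exp_ofReal_mul_I, one_mul]
  calc _ ≤ (2 * Real.pi + β / r₀) * ((2 + β / t₀) * B) + |β ^ 2 - β| / (r₀ * t₀) * B := by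
        refine (norm_add_le _ _).trans (add_le_add ?_ ?_)
        · rw [norm_mul]
          exact mul_le_mul h1 (norm_halfWave_le hς hβ ht₀ ht hu hu') (norm_nonneg _)
            (by positivity)
        · rw [norm_mul, Complex.norm_real, Real.norm_eq_abs]
          exact mul_le_mul h2 hu (abs_nonneg _) (by positivity)
    _ = _ := by ring

theorem lintegral_ofReal_average_sq_le {Ω : Type*} [MeasurableSpace Ω] {μ : Measure Ω}
    {f g : Ω → ℝ} {R : ℝ} (hf : Measurable f) (hg : Measurable g) (hR : 0 ≤ R)
    (hfR : ∫⁻ x, ENNReal.ofReal (f x ^ 2) ∂μ ≤ ENNReal.ofReal R)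
    (hgR : ∫⁻ x, ENNReal.ofReal (g x ^ 2) ∂μ ≤ ENNReal.ofReal R) :
    ∫⁻ x, ENNReal.ofReal (((f x + g x) / 2) ^ 2) ∂μ ≤ ENNReal.ofReal R := by
  calc ∫⁻ x, ENNReal.ofReal (((f x + g x) / 2) ^ 2) ∂μ
      ≤ ∫⁻ x, (ENNReal.ofReal (1 / 2) * ENNReal.ofReal (f x ^ 2) +
          ENNReal.ofReal (1 / 2) * ENNReal.ofReal (g x ^ 2)) ∂μ := by
        refine lintegral_mono fun x => ?_
        simp only
        rw [← ENNReal.ofReal_mul (by norm_num), ← ENNReal.ofReal_mul (by norm_num),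
          ← ENNReal.ofReal_add (by positivity) (by positivity)]
        refine ENNReal.ofReal_le_ofReal ?_
        nlinarith [sq_nonneg (f x - g x)]
    _ = ENNReal.ofReal (1 / 2) * ∫⁻ x, ENNReal.ofReal (f x ^ 2) ∂μ +
          ENNReal.ofReal (1 / 2) * ∫⁻ x, ENNReal.ofReal (g x ^ 2) ∂μ := by
        rw [lintegral_add_left (by fun_prop), lintegral_const_mul _ (by fun_prop),
          lintegral_const_mul _ (by fun_prop)]
    _ ≤ ENNReal.ofReal (1 / 2) * ENNReal.ofReal R +
          ENNReal.ofReal (1 / 2) * ENNReal.ofReal R := by gcongr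
    _ = ENNReal.ofReal R := by
        rw [← ENNReal.ofReal_mul (by norm_num), ← ENNReal.ofReal_add (by positivity)
          (by positivity)]
        congr 1; ring

theorem norm_shellExtension_profile_le {d n : ℕ} (hum : Measurable u) (hum' : Measurable u')
    {F : EuclideanSpace ℝ (Fin d) → ℂ} (hFm : Measurable F)
    (hF : MemLp F 2 (volume.restrict (unitShell (EuclideanSpace ℝ (Fin d)) n))) {r D : ℝ}
    (hD : ∀ ς : ℝ, |ς| = 1 → ∀ s ∈ Set.Ico (n : ℝ) (n + 1), ‖demodulatedWave u u' β ς n r s‖ ≤ D)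
    (x : EuclideanSpace ℝ (Fin d)) :
    ‖shellExtension n (fun ξ => F ξ * (u (2 * Real.pi * r * ‖ξ‖) : ℂ)) x‖ ≤
      (‖shellExtension n (fun ξ => F ξ * demodulatedWave u u' β 1 n r ‖ξ‖) x‖ +
        ‖shellExtension n (fun ξ => F ξ * demodulatedWave u u' β (-1) n r ‖ξ‖) x‖) / 2 := by
  have hi : ∀ ς : ℝ, |ς| = 1 → Integrable (fun ξ : EuclideanSpace ℝ (Fin d) =>
      F ξ * demodulatedWave u u' β ς n r ‖ξ‖ *
        Complex.exp ((2 * Real.pi * inner ℝ x ξ : ℝ) * Complex.I))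
      (volume.restrict (unitShell (EuclideanSpace ℝ (Fin d)) n)) := fun ς hς =>
    ((memLp_mul_comp_norm hFm hF (measurable_demodulatedWave hum hum' ς n).of_uncurry_left
      (hD ς hς)).1.integrable
      (by norm_num)).mul_bdd (c := 1) (Continuous.aestronglyMeasurable (by fun_prop))
      (Filter.Eventually.of_forall fun ξ => (Complex.norm_exp_ofReal_mul_I _).le)
  set w : ℝ → ℂ := fun ς => Complex.exp (((ς * (2 * Real.pi * n)) * r : ℝ) * Complex.I) with hw
  have hsplit : 2 * Complex.I *
      shellExtension n (fun ξ => F ξ * (u (2 * Real.pi * r * ‖ξ‖) : ℂ)) x =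
      w 1 * shellExtension n (fun ξ => F ξ * demodulatedWave u u' β 1 n r ‖ξ‖) x -
      w (-1) * shellExtension n (fun ξ => F ξ * demodulatedWave u u' β (-1) n r ‖ξ‖) x := by
    unfold shellExtension
    rw [← integral_const_mul, ← integral_const_mul, ← integral_const_mul,
      ← integral_sub ((hi 1 (by simp)).const_mul _) ((hi (-1) (by simp)).const_mul _)]
    congr with ξ
    have hcancel : ∀ ς : ℝ, w ς * demodulatedWave u u' β ς n r ‖ξ‖ =
        halfWave u u' β ς (2 * Real.pi * r * ‖ξ‖) := fun ς => by
      rw [hw, demodulatedWave, ← mul_assoc, ← Complex.exp_add]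
      simp
    have h1 := halfWave_one_sub_halfWave_neg_one u u' β (2 * Real.pi * r * ‖ξ‖)
    rw [← hcancel, ← hcancel] at h1
    linear_combination (-F ξ * Complex.exp ((2 * Real.pi * inner ℝ x ξ : ℝ) * Complex.I)) * h1
  have h2 := congrArg norm hsplit
  rw [norm_mul, norm_mul, Complex.norm_I, Complex.norm_two, mul_one] at h2
  have h3 := norm_sub_le
    (w 1 * shellExtension n (fun ξ => F ξ * demodulatedWave u u' β 1 n r ‖ξ‖) x)
    (w (-1) * shellExtension n (fun ξ => F ξ * demodulatedWave u u' β (-1) n r ‖ξ‖) x)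
  rw [norm_mul, norm_mul, hw, Complex.norm_exp_ofReal_mul_I, Complex.norm_exp_ofReal_mul_I,
    one_mul, one_mul] at h3
  rw [le_div_iff₀ two_pos]
  linarith

theorem exists_profile_shell_maximal {d : ℕ} {μ : Measure (EuclideanSpace ℝ (Fin d))}
    [IsFiniteMeasure μ] (hβ : 0 ≤ β) (hum : Measurable u) (hum' : Measurable u')
    (hu : ∀ t, 0 < t → HasDerivAt u (u' t) t)
    (hu' : ∀ t, 0 < t → HasDerivAt u' (-u t - 2 * β / t * u' t) t)
    {a b B : ℝ} (ha : 0 < a) (hab : a ≤ b)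
    (huB : ∀ t, 2 * Real.pi * a ≤ t → |u t| ≤ B * t ^ (-β) ∧ |u' t| ≤ B * t ^ (-β)) (hB : 0 ≤ B) :
    ∃ A : ℝ, 0 ≤ A ∧ ∀ n : ℕ, 0 < n → ∀ M : ℝ, 0 < M →
      (∀ x, ∫ y, ‖(shellKernel n (x - y) : ℂ)‖ ∂μ ≤ M) →
      ∀ F : EuclideanSpace ℝ (Fin d) → ℂ, Measurable F →
      MemLp F 2 (volume.restrict (unitShell (EuclideanSpace ℝ (Fin d)) n)) →
      ∃ H : EuclideanSpace ℝ (Fin d) → ℝ, Measurable H ∧ (∀ x, 0 ≤ H x) ∧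
        (∀ x, ∀ r ∈ Set.Icc a b,
          ‖shellExtension n (fun ξ => F ξ * (u (2 * Real.pi * r * ‖ξ‖) : ℂ)) x‖ ≤ H x) ∧
        ∫⁻ x, ENNReal.ofReal (H x ^ 2) ∂μ ≤ ENNReal.ofReal (A * M * (n : ℝ) ^ (-(2 * β)) *
          ∫ ξ in unitShell (EuclideanSpace ℝ (Fin d)) n, ‖F ξ‖ ^ 2) := by
  set t₀ := 2 * Real.pi * a with ht₀
  have ht₀' : 0 < t₀ := by positivity
  set D₀ := (2 * Real.pi + β / a + 1) * (2 + β / t₀) + |β ^ 2 - β| / (a * t₀) with hD₀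
  refine ⟨2 * (1 + (b - a) ^ 2) * (D₀ * (B * t₀ ^ (-β))) ^ 2, by positivity,
    fun n hn M hM hK F hFm hF => ?_⟩
  have hn' : (1 : ℝ) ≤ n := by exact_mod_cast hn
  set B' := B * t₀ ^ (-β) * (n : ℝ) ^ (-β) with hB'
  have hB'0 : 0 ≤ B' := by positivity
  have hbounds : ∀ r ∈ Set.Icc a b, ∀ s ∈ Set.Ico (n : ℝ) (n + 1), t₀ ≤ 2 * Real.pi * r * s ∧
      |u (2 * Real.pi * r * s)| ≤ B' ∧ |u' (2 * Real.pi * r * s)| ≤ B' := by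
    intro r hr s hs
    have h1 : t₀ * n ≤ 2 * Real.pi * r * s := by
      rw [ht₀]
      have := hr.1
      have := hs.1
      have : 0 ≤ r := ha.le.trans hr.1
      gcongr
    have h2 : t₀ ≤ 2 * Real.pi * r * s := (le_mul_of_one_le_right ht₀'.le hn').trans h1
    have h3 : B * (2 * Real.pi * r * s) ^ (-β) ≤ B' := by
      rw [hB', mul_assoc B, ← Real.mul_rpow ht₀'.le (by positivity)]
      exact mul_le_mul_of_nonneg_left
        (Real.rpow_le_rpow_of_nonpos (by positivity) h1 (by linarith)) hB
    exact ⟨h2, (huB _ h2).1.trans h3, (huB _ h2).2.trans h3⟩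
  have hwave : ∀ ς : ℝ, |ς| = 1 → ∃ H : EuclideanSpace ℝ (Fin d) → ℝ, Measurable H ∧
      (∀ x, 0 ≤ H x) ∧ (∀ x, ∀ r ∈ Set.Icc a b,
        ‖shellExtension n (fun ξ => F ξ * demodulatedWave u u' β ς n r ‖ξ‖) x‖ ≤ H x) ∧
      ∫⁻ x, ENNReal.ofReal (H x ^ 2) ∂μ ≤ ENNReal.ofReal (2 * (1 + (b - a) ^ 2) * M *
        (D₀ * B') ^ 2 * ∫ ξ in unitShell (EuclideanSpace ℝ (Fin d)) n, ‖F ξ‖ ^ 2) := by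
    intro ς hς
    refine exists_shellExtension_maximal hM hK hFm hF hab
      (measurable_demodulatedWave hum hum' ς n)
      (measurable_demodulatedWaveDeriv (β := β) hum hum' ς n)
      (fun r hr s hs => ?_) (fun r hr s hs => ?_) (fun r hr s hs => ?_)
    · exact hasDerivAt_demodulatedWave hu hu' ((sq_abs ς).symm.trans (by rw [hς, one_pow]))
        (ha.trans_le hr.1) (by linarith [hs.1])
    · obtain ⟨h1, h2, h3⟩ := hbounds r hr s hs
      refine (norm_demodulatedWave_le hς hβ ht₀' h1 h2 h3).trans ?_
      refine mul_le_mul_of_nonneg_right ?_ hB'0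
      rw [hD₀]
      have h4 : 0 ≤ (2 * Real.pi + β / a) * (2 + β / t₀) := by positivity
      have h5 : 0 ≤ |β ^ 2 - β| / (a * t₀) := by positivity
      linarith
    · obtain ⟨h1, h2, h3⟩ := hbounds r hr s hs
      refine (norm_demodulatedWaveDeriv_le hς hβ ha hr.1 ht₀' h1 ?_ h2 h3).trans ?_
      · rw [abs_of_nonneg (by linarith [hs.1])]; linarith [hs.2]
      · refine mul_le_mul_of_nonneg_right ?_ hB'0
        rw [hD₀]
        have h4 : 0 ≤ 2 + β / t₀ := by positivity
        linarith
  obtain ⟨H₁, hm₁, hnn₁, hle₁, hint₁⟩ := hwave 1 (by simp)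
  obtain ⟨H₂, hm₂, hnn₂, hle₂, hint₂⟩ := hwave (-1) (by simp)
  have hI0 : 0 ≤ ∫ ξ in unitShell (EuclideanSpace ℝ (Fin d)) n, ‖F ξ‖ ^ 2 :=
    integral_nonneg fun ξ => by positivity
  refine ⟨fun x => (H₁ x + H₂ x) / 2, (hm₁.add hm₂).div_const 2,
    fun x => div_nonneg (add_nonneg (hnn₁ x) (hnn₂ x)) zero_le_two, fun x r hr => ?_, ?_⟩
  · refine (norm_shellExtension_profile_le hum hum' hFm hF (β := β) (fun ς hς s hs =>
      norm_demodulatedWave_le hς hβ ht₀' (hbounds r hr s hs).1 (hbounds r hr s hs).2.1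
        (hbounds r hr s hs).2.2) x).trans ?_
    have := hle₁ x r hr
    have := hle₂ x r hr
    linarith
  · refine (lintegral_ofReal_average_sq_le hm₁ hm₂ (by positivity) hint₁ hint₂).trans_eq ?_
    congr 2
    rw [hB', show -(2 * β) = -β + -β by ring, Real.rpow_add (by positivity)]
    ring

end HalfWave

section FourierSide

open FourierTransform

theorem SchwartzMap.integrable_one_add_rpow_mul_norm_sq {E : Type*} [NormedAddCommGroup E]
    [InnerProductSpace ℝ E] [FiniteDimensional ℝ E] [MeasurableSpace E] [BorelSpace E]
    (s : ℝ) (φ : SchwartzMap E ℂ) : Integrable fun ξ => (1 + ‖ξ‖ ^ 2) ^ s * ‖φ ξ‖ ^ 2 := by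
  have hg : (fun ξ : E => (1 + ‖ξ‖ ^ 2) ^ (s / 2)).HasTemperateGrowth := by fun_prop
  have h := ((SchwartzMap.smulLeftCLM ℂ (fun ξ : E => (1 + ‖ξ‖ ^ 2) ^ (s / 2)) φ).memLp
    2 volume).integrable_norm_pow two_ne_zero
  refine h.congr (Filter.Eventually.of_forall fun ξ => ?_)
  have h0 : (0 : ℝ) ≤ 1 + ‖ξ‖ ^ 2 := by positivity
  simp only [SchwartzMap.smulLeftCLM_apply_apply hg, norm_smul, mul_pow, Real.norm_eq_abs, sq_abs]
  rw [← Real.rpow_natCast, ← Real.rpow_mul h0]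
  norm_num

theorem IsRotationInvariant.integral_schwartzMap_sub_smul {d : ℕ}
    {σ : Measure (EuclideanSpace ℝ (Fin d))} [IsFiniteMeasure σ] (hσ : IsRotationInvariant σ)
    (i : Fin d) (g : SchwartzMap (EuclideanSpace ℝ (Fin d)) ℂ) (x : EuclideanSpace ℝ (Fin d))
    {r : ℝ} (hr : 0 ≤ r) :
    ∫ ω, g (x - r • ω) ∂σ = ∫ ξ, 𝓕 (⇑g) ξ * (sphereProfile σ i (2 * Real.pi * r * ‖ξ‖) : ℂ) *
      Complex.exp ((2 * Real.pi * inner ℝ x ξ : ℝ) * Complex.I) := by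
  have hF : Integrable (𝓕 (⇑g)) := by
    rw [← SchwartzMap.fourier_coe]; exact (𝓕 g).integrable
  have hinv : ∀ y, g y =
      ∫ ξ, 𝓕 (⇑g) ξ * Complex.exp ((2 * Real.pi * inner ℝ y ξ : ℝ) * Complex.I) := by
    intro y
    conv_lhs => rw [← g.continuous.fourierInv_fourier_eq g.integrable hF]
    rw [Real.fourierInv_eq']
    refine integral_congr_ae (Filter.Eventually.of_forall fun ξ => ?_)
    simp only [smul_eq_mul]
    rw [mul_comm, real_inner_comm]
  simp_rw [hinv]
  rw [integral_integral_swap]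
  · refine integral_congr_ae (Filter.Eventually.of_forall fun ξ => ?_)
    simp only
    have h1 : ∀ ω : EuclideanSpace ℝ (Fin d),
        𝓕 (⇑g) ξ * Complex.exp ((2 * Real.pi * inner ℝ (x - r • ω) ξ : ℝ) * Complex.I) =
        𝓕 (⇑g) ξ * Complex.exp ((2 * Real.pi * inner ℝ x ξ : ℝ) * Complex.I) *
          Complex.exp ((inner ℝ (-(2 * Real.pi * r) • ξ) ω : ℝ) * Complex.I) := by
      intro ω
      rw [mul_assoc (𝓕 (⇑g) ξ), ← Complex.exp_add]
      congr 2
      rw [inner_sub_left, inner_smul_left, inner_smul_left, real_inner_comm ω ξ]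
      simp only [conj_trivial]
      push_cast
      ring
    simp_rw [h1]
    rw [integral_const_mul, hσ.integral_cexp_inner i]
    have h2 : ‖-(2 * Real.pi * r) • ξ‖ = 2 * Real.pi * r * ‖ξ‖ := by
      rw [norm_smul, norm_neg, Real.norm_of_nonneg (by positivity)]
    rw [h2]
    ring
  · have h3 : Integrable (fun p : EuclideanSpace ℝ (Fin d) × EuclideanSpace ℝ (Fin d) =>
        𝓕 (⇑g) p.2) (σ.prod volume) := hF.comp_snd σ
    refine h3.mul_bdd (c := 1) (Continuous.aestronglyMeasurable (by fun_prop)) ?_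
    exact Filter.Eventually.of_forall fun p => by
      rw [Complex.norm_exp_ofReal_mul_I]

end FourierSide

theorem hasSum_setIntegral_unitShell {E F : Type*} [NormedAddCommGroup E]
    [MeasurableSpace E] [BorelSpace E] {μ : Measure E} [NormedAddCommGroup F] [NormedSpace ℝ F]
    {f : E → F} (hf : Integrable f μ) :
    HasSum (fun n => ∫ ξ in unitShell E n, f ξ ∂μ) (∫ ξ, f ξ ∂μ) := by
  have hU : ⋃ n, unitShell E n = Set.univ := by
    refine Set.eq_univ_of_forall fun ξ => Set.mem_iUnion.2 ⟨⌊‖ξ‖⌋₊, ?_⟩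
    exact ⟨Nat.floor_le (norm_nonneg _), Nat.lt_floor_add_one _⟩
  have hd : Pairwise (Function.onFun Disjoint (unitShell E)) := by
    refine fun m n hmn => Set.disjoint_left.2 fun ξ hm hn => hmn ?_
    rw [← (Nat.floor_eq_iff (norm_nonneg ξ)).2 hm, (Nat.floor_eq_iff (norm_nonneg ξ)).2 hn]
  have h := hasSum_integral_iUnion (f := f) (μ := μ) (fun n => measurableSet_unitShell n) hd
    hf.integrableOn
  rwa [hU, setIntegral_univ] at h

theorem rpow_neg_le_two_rpow_mul {x y β : ℝ} (hx : 0 < x) (hy : 0 < y) (hyx : y ≤ 2 * x)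
    (hβ : 0 ≤ β) : x ^ (-β) ≤ 2 ^ β * y ^ (-β) := by
  have h : (y / 2) ^ β ≤ x ^ β := Real.rpow_le_rpow (by positivity) (by linarith) hβ
  rw [Real.div_rpow hy.le zero_le_two] at h
  rw [Real.rpow_neg hx.le, Real.rpow_neg hy.le, ← div_eq_mul_inv,
    inv_le_comm₀ (by positivity) (by positivity), inv_div]
  exact h

theorem rpow_le_two_rpow_abs_mul {x y : ℝ} (hx : 0 < x) (hy : 0 < y) (hxy : x ≤ 2 * y)
    (hyx : y ≤ 2 * x) (s : ℝ) : x ^ s ≤ 2 ^ |s| * y ^ s := by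
  rcases le_total 0 s with hs | hs
  · rw [abs_of_nonneg hs, ← Real.mul_rpow zero_le_two hy.le]
    exact Real.rpow_le_rpow hx.le hxy hs
  · rw [abs_of_nonpos hs]
    simpa using rpow_neg_le_two_rpow_mul hx hy hyx (neg_nonneg.2 hs)

theorem tsum_rpow_mul_setIntegral_unitShell_le {E : Type*} [NormedAddCommGroup E]
    [MeasurableSpace E] [BorelSpace E] {μ : Measure E} {s : ℝ} {F : E → ℂ}
    (hF : Integrable (fun ξ => (1 + ‖ξ‖ ^ 2) ^ s * ‖F ξ‖ ^ 2) μ) :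
    ∑' n : ℕ, ENNReal.ofReal (((n : ℝ) + 1) ^ (2 * s) * ∫ ξ in unitShell E n, ‖F ξ‖ ^ 2 ∂μ) ≤
      ENNReal.ofReal (2 ^ |s| * ∫ ξ, (1 + ‖ξ‖ ^ 2) ^ s * ‖F ξ‖ ^ 2 ∂μ) := by
  have hG := hasSum_setIntegral_unitShell (hF.const_mul (2 ^ |s|))
  rw [← integral_const_mul, ← hG.tsum_eq, ENNReal.ofReal_tsum_of_nonneg
    (fun n => integral_nonneg fun ξ => by positivity) hG.summable]
  refine ENNReal.tsum_le_tsum fun n => ENNReal.ofReal_le_ofReal ?_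
  rw [← integral_const_mul]
  refine integral_mono_of_nonneg (Filter.Eventually.of_forall fun ξ => by positivity)
    (hF.const_mul _).integrableOn ?_
  filter_upwards [ae_restrict_mem (measurableSet_unitShell n)] with ξ hξ
  have h1 : (n : ℝ) ^ 2 ≤ ‖ξ‖ ^ 2 := pow_le_pow_left₀ (by positivity) hξ.1 2
  have h2 : ‖ξ‖ ^ 2 ≤ ((n : ℝ) + 1) ^ 2 := pow_le_pow_left₀ (by positivity) hξ.2.le 2
  have h3 : (((n : ℝ) + 1) ^ 2) ^ s ≤ 2 ^ |s| * (1 + ‖ξ‖ ^ 2) ^ s := by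
    refine rpow_le_two_rpow_abs_mul (by positivity) (by positivity) ?_ ?_ s
    · nlinarith [sq_nonneg ((n : ℝ) - 1)]
    · nlinarith [n.cast_nonneg (α := ℝ)]
  rw [← Real.rpow_natCast, ← Real.rpow_mul (by positivity), Nat.cast_two] at h3
  rw [← mul_assoc]
  gcongr

theorem ENNReal.tsum_sq_le_tsum_mul_tsum_inv_mul_sq {w : ℕ → ENNReal}
    (hw0 : ∀ n, w n ≠ 0) (hw : ∀ n, w n ≠ ⊤) (h : ℕ → ENNReal) :
    (∑' n, h n) ^ 2 ≤ (∑' n, w n) * ∑' n, (w n)⁻¹ * h n ^ 2 := by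
  have key := ENNReal.lintegral_mul_le_Lp_mul_Lq Measure.count Real.HolderConjugate.two_two
    (f := fun n => w n ^ (1 / 2 : ℝ)) (g := fun n => (w n)⁻¹ ^ (1 / 2 : ℝ) * h n)
    measurable_from_nat.aemeasurable measurable_from_nat.aemeasurable
  simp only [lintegral_count, Pi.mul_apply] at key
  have h1 : ∀ n, w n ^ (1 / 2 : ℝ) * ((w n)⁻¹ ^ (1 / 2 : ℝ) * h n) = h n := fun n => by
    rw [← mul_assoc, ← ENNReal.mul_rpow_of_nonneg _ _ (by norm_num),
      ENNReal.mul_inv_cancel (hw0 n) (hw n), ENNReal.one_rpow, one_mul]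
  have h2 : ∀ n, (w n ^ (1 / 2 : ℝ)) ^ (2 : ℝ) = w n := fun n => by
    rw [← ENNReal.rpow_mul]; norm_num
  have h3 : ∀ n, ((w n)⁻¹ ^ (1 / 2 : ℝ) * h n) ^ (2 : ℝ) = (w n)⁻¹ * h n ^ 2 := fun n => by
    rw [ENNReal.mul_rpow_of_nonneg _ _ zero_le_two, ← ENNReal.rpow_mul, ← ENNReal.rpow_natCast]
    norm_num
  simp only [h1, h2, h3] at key
  have h4 := pow_le_pow_left₀ zero_le key 2
  rwa [mul_pow, ← ENNReal.rpow_natCast, ← ENNReal.rpow_natCast (_ ^ _), ← ENNReal.rpow_mul,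
    ← ENNReal.rpow_natCast (_ ^ _), ← ENNReal.rpow_mul, Nat.cast_two,
    one_div_mul_cancel two_ne_zero, ENNReal.rpow_one, ENNReal.rpow_one, ← Nat.cast_two (R := ℝ),
    ENNReal.rpow_natCast] at h4

theorem IsRotationInvariant.exists_abs_sphereProfile_le {k : ℕ}
    {σ : Measure (EuclideanSpace ℝ (Fin (k + 1)))} [IsFiniteMeasure σ]
    (hσ : IsRotationInvariant σ) (i : Fin (k + 1)) {t₀ : ℝ} (ht₀ : 0 < t₀) :
    ∃ B, 0 ≤ B ∧ ∀ t, t₀ ≤ t → |sphereProfile σ i t| ≤ B * t ^ (-(k / 2 : ℝ)) ∧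
      |sphereProfileDeriv σ i t| ≤ B * t ^ (-(k / 2 : ℝ)) :=
  bessel_decay k (fun t _ => hσ.hasDerivAt_sphereProfile i t)
    (fun t ht => (hσ.hasDerivAt_sphereProfileDeriv i t).congr_deriv
      (by simpa using hσ.bessel_equation i ht.ne')) ht₀

theorem IsRotationInvariant.exists_abs_sphereProfile_le_one_add {k : ℕ}
    {σ : Measure (EuclideanSpace ℝ (Fin (k + 1)))} [IsFiniteMeasure σ]
    (hσ : IsRotationInvariant σ) (i : Fin (k + 1)) :
    ∃ B, 0 ≤ B ∧ ∀ t, 0 ≤ t → |sphereProfile σ i t| ≤ B * (1 + t) ^ (-(k / 2 : ℝ)) := by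
  obtain ⟨B, hB0, hB⟩ := hσ.exists_abs_sphereProfile_le i one_pos
  have hk : (0 : ℝ) ≤ k / 2 := by positivity
  refine ⟨(B + σ.real Set.univ) * 2 ^ (k / 2 : ℝ), by positivity, fun t ht => ?_⟩
  have hp : (0 : ℝ) < 2 ^ (k / 2 : ℝ) := by positivity
  rcases le_total 1 t with h1 | h1
  · have h2 : t ^ (-(k / 2 : ℝ)) ≤ 2 ^ (k / 2 : ℝ) * (1 + t) ^ (-(k / 2 : ℝ)) :=
      rpow_neg_le_two_rpow_mul (by positivity) (by positivity) (by linarith) hk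
    calc |sphereProfile σ i t| ≤ B * t ^ (-(k / 2 : ℝ)) := (hB t h1).1
      _ ≤ (B + σ.real Set.univ) * (2 ^ (k / 2 : ℝ) * (1 + t) ^ (-(k / 2 : ℝ))) :=
          mul_le_mul (le_add_of_nonneg_right measureReal_nonneg) h2 (by positivity) (by positivity)
      _ = _ := by ring
  · have h2 : 1 ≤ 2 ^ (k / 2 : ℝ) * (1 + t) ^ (-(k / 2 : ℝ)) := by
      rw [Real.rpow_neg (by positivity), ← div_eq_mul_inv, one_le_div (by positivity)]
      exact Real.rpow_le_rpow (by positivity) (by linarith) hk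
    calc |sphereProfile σ i t| ≤ σ.real Set.univ := abs_sphereProfile_le i t
      _ ≤ (B + σ.real Set.univ) * 1 := by linarith
      _ ≤ (B + σ.real Set.univ) * (2 ^ (k / 2 : ℝ) * (1 + t) ^ (-(k / 2 : ℝ))) := by gcongr
      _ = _ := by ring

theorem IsRotationInvariant.exists_shell_majorant {k : ℕ} {α C a b : ℝ}
    {σ μ : Measure (EuclideanSpace ℝ (Fin (k + 1)))} [IsFiniteMeasure σ] [IsFiniteMeasure μ]
    (hσ : IsRotationInvariant σ) (i : Fin (k + 1)) (hα0 : 0 ≤ α) (hα : α < k / 2)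
    (hfrost : ∀ (x : EuclideanSpace ℝ (Fin (k + 1))) (δ : ℝ), 0 < δ →
      μ (ball x δ) ≤ ENNReal.ofReal (C * δ ^ α)) (ha : 0 < a) (hab : a ≤ b) :
    ∃ A, 0 ≤ A ∧ ∀ n : ℕ, ∀ F : EuclideanSpace ℝ (Fin (k + 1)) → ℂ, Measurable F →
      MemLp F 2 (volume.restrict (unitShell _ n)) →
      ∃ H : EuclideanSpace ℝ (Fin (k + 1)) → ℝ, Measurable H ∧ (∀ x, 0 ≤ H x) ∧
        (∀ x, ∀ r ∈ Set.Icc a b, ‖shellExtension n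
          (fun ξ => F ξ * (sphereProfile σ i (2 * Real.pi * r * ‖ξ‖) : ℂ)) x‖ ≤ H x) ∧
        ∫⁻ x, ENNReal.ofReal (H x ^ 2) ∂μ ≤ ENNReal.ofReal (A * ((n : ℝ) + 1) ^ (-α) *
          ∫ ξ in unitShell (EuclideanSpace ℝ (Fin (k + 1))) n, ‖F ξ‖ ^ 2) := by
  rcases eq_or_ne σ 0 with rfl | hσ0
  · refine ⟨0, le_rfl, fun n F _ _ => ⟨fun _ => 0, measurable_const, fun _ => le_rfl, ?_, ?_⟩⟩
    · intro x r _
      simp [shellExtension, sphereProfile]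
    · simp
  have hk : (0 : ℝ) ≤ k / 2 := by positivity
  obtain ⟨B₁, hB₁0, hB₁⟩ := hσ.exists_abs_sphereProfile_le_one_add i
  obtain ⟨A₁, hA₁0, hA₁⟩ := exists_integral_norm_shellKernel_le hσ hσ0 i hα hk hB₁0 hB₁ hfrost
  obtain ⟨B₂, hB₂0, hB₂⟩ := hσ.exists_abs_sphereProfile_le i
    (show 0 < 2 * Real.pi * a by positivity)
  have hum : Measurable (sphereProfile σ i) := (continuous_iff_continuousAt.2
    fun t => (hσ.hasDerivAt_sphereProfile i t).continuousAt).measurable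
  have hum' : Measurable (sphereProfileDeriv σ i) := (continuous_iff_continuousAt.2
    fun t => (hσ.hasDerivAt_sphereProfileDeriv i t).continuousAt).measurable
  obtain ⟨A₂, hA₂0, hA₂⟩ := exists_profile_shell_maximal (μ := μ) hk hum hum'
    (fun t _ => hσ.hasDerivAt_sphereProfile i t)
    (fun t ht => (hσ.hasDerivAt_sphereProfileDeriv i t).congr_deriv (by
      rw [hσ.bessel_equation i ht.ne', mul_div_cancel₀ _ two_ne_zero, Nat.add_sub_cancel]))
    ha hab hB₂ hB₂0
  set E := EuclideanSpace ℝ (Fin (k + 1)) with hE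
  set A₀ := μ.real Set.univ * (σ.real Set.univ ^ 2 * volume.real (unitShell E 0)) with hA₀
  refine ⟨A₀ + A₂ * A₁ * 2 ^ α, by positivity, fun n F hFm hF => ?_⟩
  have hI0 : 0 ≤ ∫ ξ in unitShell E n, ‖F ξ‖ ^ 2 := integral_nonneg fun _ => by positivity
  rcases Nat.eq_zero_or_pos n with rfl | hn
  · refine ⟨fun _ => σ.real Set.univ * ∫ ξ in unitShell E 0, ‖F ξ‖, measurable_const,
      fun _ => by positivity, fun x r _ => ?_, ?_⟩
    · refine (norm_shellExtension_le _ _ _).trans ?_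
      rw [← integral_const_mul]
      have hF1 : Integrable F (volume.restrict (unitShell E 0)) := hF.integrable (by norm_num)
      refine integral_mono_of_nonneg (Filter.Eventually.of_forall fun _ => norm_nonneg _)
        (hF1.norm.const_mul _) (Filter.Eventually.of_forall fun ξ => ?_)
      simp only [norm_mul, Complex.norm_real, Real.norm_eq_abs]
      rw [mul_comm]
      gcongr
      exact abs_sphereProfile_le i _
    · rw [lintegral_const, ← ofReal_measureReal, ← ENNReal.ofReal_mul (by positivity)]
      refine ENNReal.ofReal_le_ofReal ?_
      have h1 := sq_integral_le_mul_integral_sq hF.norm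
      simp only [measureReal_restrict_apply_univ] at h1
      simp only [Nat.cast_zero, zero_add, Real.one_rpow, mul_one]
      calc (σ.real Set.univ * ∫ ξ in unitShell E 0, ‖F ξ‖) ^ 2 * μ.real Set.univ
          = μ.real Set.univ * σ.real Set.univ ^ 2 * (∫ ξ in unitShell E 0, ‖F ξ‖) ^ 2 := by ring
        _ ≤ μ.real Set.univ * σ.real Set.univ ^ 2 *
            (volume.real (unitShell E 0) * ∫ ξ in unitShell E 0, ‖F ξ‖ ^ 2) := by gcongr
        _ = A₀ * ∫ ξ in unitShell E 0, ‖F ξ‖ ^ 2 := by rw [hA₀]; ring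
        _ ≤ _ := mul_le_mul_of_nonneg_right (le_add_of_nonneg_right (by positivity)) hI0
  · have hn0 : (0 : ℝ) < n := by exact_mod_cast hn
    obtain ⟨H, hH⟩ := hA₂ n hn (A₁ * (n : ℝ) ^ ((k : ℝ) - α)) (by positivity) (hA₁ n hn) F hFm hF
    refine ⟨H, hH.1, hH.2.1, hH.2.2.1, hH.2.2.2.trans (ENNReal.ofReal_le_ofReal ?_)⟩
    refine mul_le_mul_of_nonneg_right ?_ hI0
    have h1 : (n : ℝ) ^ ((k : ℝ) - α) * (n : ℝ) ^ (-(2 * (k / 2 : ℝ))) = (n : ℝ) ^ (-α) := by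
      rw [← Real.rpow_add hn0]
      ring_nf
    have h2 : (n : ℝ) ^ (-α) ≤ 2 ^ α * ((n : ℝ) + 1) ^ (-α) := by
      have h3 : (1 : ℝ) ≤ n := by exact_mod_cast hn
      exact rpow_neg_le_two_rpow_mul hn0 (by positivity) (by linarith) hα0
    calc A₂ * (A₁ * (n : ℝ) ^ ((k : ℝ) - α)) * (n : ℝ) ^ (-(2 * (k / 2 : ℝ)))
        = A₂ * A₁ * ((n : ℝ) ^ ((k : ℝ) - α) * (n : ℝ) ^ (-(2 * (k / 2 : ℝ)))) := by ring
      _ ≤ A₂ * A₁ * (2 ^ α * ((n : ℝ) + 1) ^ (-α)) := by rw [h1]; gcongr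
      _ = A₂ * A₁ * 2 ^ α * ((n : ℝ) + 1) ^ (-α) := by ring
      _ ≤ _ := by gcongr; exact le_add_of_nonneg_left (by positivity)

open FourierTransform in
theorem IsRotationInvariant.exists_lintegral_maximal_sq_le {k : ℕ} {α C a b ε : ℝ}
    {σ μ : Measure (EuclideanSpace ℝ (Fin (k + 1)))} [IsFiniteMeasure σ] [IsFiniteMeasure μ]
    (hσ : IsRotationInvariant σ) (hα0 : 0 ≤ α) (hα : α < k / 2)
    (hfrost : ∀ (x : EuclideanSpace ℝ (Fin (k + 1))) (δ : ℝ), 0 < δ →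
      μ (ball x δ) ≤ ENNReal.ofReal (C * δ ^ α)) (ha : 0 < a) (hab : a ≤ b) (hε : 0 < ε) :
    ∃ A, 0 ≤ A ∧ ∀ g : SchwartzMap (EuclideanSpace ℝ (Fin (k + 1))) ℂ,
      ∃ H : EuclideanSpace ℝ (Fin (k + 1)) → ENNReal, Measurable H ∧
        (∀ x, ∀ r ∈ Set.Icc a b, ‖∫ ω, g (x - r • ω) ∂σ‖ₑ ≤ H x) ∧
        ∫⁻ x, H x ^ 2 ∂μ ≤
          ENNReal.ofReal (A * ∫ ξ, (1 + ‖ξ‖ ^ 2) ^ ((1 - α) / 2 + ε) * ‖𝓕 (⇑g) ξ‖ ^ 2) := by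
  obtain ⟨A, hA0, hA⟩ := hσ.exists_shell_majorant 0 hα0 hα hfrost ha hab
  set s := (1 - α) / 2 + ε with hs
  have hwsum : Summable fun n : ℕ => ((n : ℝ) + 1) ^ (-(1 + 2 * ε)) := by
    have h := (summable_nat_add_iff 1).2
      (Real.summable_nat_rpow.2 (show -(1 + 2 * ε) < -1 by linarith))
    simpa using h
  set W := ∑' n : ℕ, ((n : ℝ) + 1) ^ (-(1 + 2 * ε)) with hW
  have hW0 : 0 ≤ W := tsum_nonneg fun n => by positivity
  refine ⟨W * (A * 2 ^ |s|), by positivity, fun g => ?_⟩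
  obtain ⟨G, hFc⟩ : ∃ G : SchwartzMap (EuclideanSpace ℝ (Fin (k + 1))) ℂ, 𝓕 (⇑g) = ⇑G :=
    ⟨𝓕 g, (SchwartzMap.fourier_coe g).symm⟩
  have hF2 : ∀ n, MemLp (𝓕 (⇑g)) 2 (volume.restrict (unitShell _ n)) := fun n => by
    rw [hFc]; exact (G.memLp 2 volume).restrict _
  have hFm : Measurable (𝓕 (⇑g)) := by rw [hFc]; exact G.continuous.measurable
  have hFint : Integrable fun ξ => (1 + ‖ξ‖ ^ 2) ^ s * ‖𝓕 (⇑g) ξ‖ ^ 2 := by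
    rw [hFc]; exact G.integrable_one_add_rpow_mul_norm_sq s
  choose H hHm hH0 hHle hHint using fun n => hA n _ hFm (hF2 n)
  refine ⟨fun x => ∑' n, ENNReal.ofReal (H n x),
    Measurable.tsum fun n => (hHm n).ennreal_ofReal, fun x r hr => ?_, ?_⟩
  · have hr0 : 0 ≤ r := ha.le.trans hr.1
    have hint : Integrable fun ξ => 𝓕 (⇑g) ξ * (sphereProfile σ 0 (2 * Real.pi * r * ‖ξ‖) : ℂ) *
        Complex.exp ((2 * Real.pi * inner ℝ x ξ : ℝ) * Complex.I) := by
      have h1 : Integrable (𝓕 (⇑g)) := by rw [hFc]; exact G.integrable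
      have h2 : Continuous (sphereProfile σ 0) := continuous_iff_continuousAt.2
        fun t => (hσ.hasDerivAt_sphereProfile 0 t).continuousAt
      refine (h1.mul_bdd (c := σ.real Set.univ) (Continuous.aestronglyMeasurable (by fun_prop))
        (Filter.Eventually.of_forall fun ξ => ?_)).mul_bdd (c := 1)
        (Continuous.aestronglyMeasurable (by fun_prop)) (Filter.Eventually.of_forall fun ξ => ?_)
      · rw [Complex.norm_real]
        exact abs_sphereProfile_le 0 _
      · rw [Complex.norm_exp_ofReal_mul_I]
    rw [hσ.integral_schwartzMap_sub_smul 0 g x hr0,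
      ← (hasSum_setIntegral_unitShell hint).tsum_eq]
    refine enorm_tsum_le_tsum_enorm.trans (ENNReal.tsum_le_tsum fun n => ?_)
    rw [← ofReal_norm]
    exact ENNReal.ofReal_le_ofReal (hHle n x r hr)
  · have hw0 : ∀ n : ℕ, ENNReal.ofReal (((n : ℝ) + 1) ^ (-(1 + 2 * ε))) ≠ 0 := fun n => by
      rw [ne_eq, ENNReal.ofReal_eq_zero, not_le]; positivity
    have hterm : ∀ n : ℕ, (ENNReal.ofReal (((n : ℝ) + 1) ^ (-(1 + 2 * ε))))⁻¹ *
        ∫⁻ x, ENNReal.ofReal (H n x) ^ 2 ∂μ ≤ ENNReal.ofReal A *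
          ENNReal.ofReal (((n : ℝ) + 1) ^ (2 * s) * ∫ ξ in unitShell _ n, ‖𝓕 (⇑g) ξ‖ ^ 2) := by
      intro n
      have hn : (0 : ℝ) < (n : ℝ) + 1 := by positivity
      rw [← ENNReal.ofReal_inv_of_pos (by positivity), ← ENNReal.ofReal_mul hA0]
      simp only [← ENNReal.ofReal_pow (hH0 n _)]
      refine (mul_le_mul_right (hHint n) _).trans_eq ?_
      rw [← ENNReal.ofReal_mul (by positivity), ← Real.rpow_neg hn.le, neg_neg]
      congr 1
      have h1 : ((n : ℝ) + 1) ^ (1 + 2 * ε) * ((n : ℝ) + 1) ^ (-α) = ((n : ℝ) + 1) ^ (2 * s) := by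
        rw [← Real.rpow_add hn, hs]
        ring_nf
      rw [← h1]
      ring
    calc ∫⁻ x, (∑' n, ENNReal.ofReal (H n x)) ^ 2 ∂μ
        ≤ ∫⁻ x, (∑' n : ℕ, ENNReal.ofReal (((n : ℝ) + 1) ^ (-(1 + 2 * ε)))) *
            ∑' n : ℕ, (ENNReal.ofReal (((n : ℝ) + 1) ^ (-(1 + 2 * ε))))⁻¹ *
              ENNReal.ofReal (H n x) ^ 2 ∂μ :=
          lintegral_mono fun x => ENNReal.tsum_sq_le_tsum_mul_tsum_inv_mul_sq hw0
            (fun n => ENNReal.ofReal_ne_top) _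
      _ = ENNReal.ofReal W * ∑' n : ℕ, (ENNReal.ofReal (((n : ℝ) + 1) ^ (-(1 + 2 * ε))))⁻¹ *
            ∫⁻ x, ENNReal.ofReal (H n x) ^ 2 ∂μ := by
          have hm : ∀ n, Measurable fun x => ENNReal.ofReal (H n x) ^ 2 :=
            fun n => (hHm n).ennreal_ofReal.pow_const 2
          rw [lintegral_const_mul _ (Measurable.tsum fun n => (hm n).const_mul _),
            lintegral_tsum fun n => ((hm n).const_mul _).aemeasurable,
            hW, ENNReal.ofReal_tsum_of_nonneg (fun n => by positivity) hwsum]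
          simp only [lintegral_const_mul _ (hm _)]
      _ ≤ ENNReal.ofReal W * (ENNReal.ofReal A *
            ENNReal.ofReal (2 ^ |s| * ∫ ξ, (1 + ‖ξ‖ ^ 2) ^ s * ‖𝓕 (⇑g) ξ‖ ^ 2)) := by
          refine mul_le_mul_right ((ENNReal.tsum_le_tsum hterm).trans ?_) _
          rw [ENNReal.tsum_mul_left]
          exact mul_le_mul_right (tsum_rpow_mul_setIntegral_unitShell_le hFint) _
      _ = _ := by
          rw [← ENNReal.ofReal_mul hA0, ← ENNReal.ofReal_mul hW0]
          congr 1
          ring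

theorem measure_univ_lt_top_of_isCompact_of_ball_lt_top {E : Type*} [PseudoMetricSpace E]
    [MeasurableSpace E] {μ : Measure E} {K : Set E} (hK : IsCompact K) (hKc : μ Kᶜ = 0)
    {δ : ℝ} (hδ : 0 < δ) (hb : ∀ x, μ (ball x δ) < ⊤) : μ Set.univ < ⊤ := by
  have h : μ K < ⊤ := hK.measure_lt_top_of_nhdsWithin fun x _ =>
    ⟨ball x δ, mem_nhdsWithin_of_mem_nhds (ball_mem_nhds x hδ), hb x⟩
  rw [← Set.union_compl_self K]
  refine (measure_union_le _ _).trans_lt ?_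
  rwa [hKc, add_zero]

/-- Theorem 1: fractal spherical maximal function estimate. If `λ` is a compactly
supported measure on `ℝ^d` with `λ(B(x,δ)) ≤ C δ^α` for some `α ∈ (0,(d-1)/2)`, then
for `ε > 0`, `0 < q < 2` and `0 < r_0 < R_0 < ∞`,
`(∫ (sup_{r_0<r<R_0} |Sf(x,r)|)^q dλ(x))^{1/q} ≲ ‖f‖_{W^{2,(1-α)/2+ε}}`
for Schwartz functions `f`. -/
theorem stmt_3 (d : ℕ) (hd : 2 ≤ d) (lam : Measure (EuclideanSpace ℝ (Fin d)))
    (hcomp : ∃ K : Set (EuclideanSpace ℝ (Fin d)), IsCompact K ∧ lam Kᶜ = 0)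
    (α C : ℝ) (hα0 : 0 < α) (hα1 : α < ((d : ℝ) - 1) / 2)
    (hfrost : ∀ (x : EuclideanSpace ℝ (Fin d)) (δ : ℝ), 0 < δ →
      lam (Metric.ball x δ) ≤ ENNReal.ofReal (C * δ ^ α))
    (ε : ℝ) (hε : 0 < ε) (q : ℝ) (hq0 : 0 < q) (hq2 : q < 2)
    (r0 R0 : ℝ) (hr0 : 0 < r0) (hR0 : r0 < R0) :
    ∃ C' > 0, ∀ f : SchwartzMap (EuclideanSpace ℝ (Fin d)) ℝ,
      (∫⁻ x, ENNReal.ofReal (⨆ r : Set.Ioo r0 R0, |sphAvg (⇑f) x r|) ^ q ∂lam) ^ (1 / q)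
        ≤ ENNReal.ofReal (C' * sobolevNorm ((1 - α) / 2 + ε) (⇑f)) := by
  obtain ⟨k, rfl⟩ : ∃ k, d = k + 1 := ⟨d - 1, by omega⟩
  have hdk : ((k + 1 : ℕ) : ℝ) - 1 = k := by push_cast; ring
  rw [hdk] at hα1
  obtain ⟨K, hK, hKc⟩ := hcomp
  have : IsFiniteMeasure lam := ⟨measure_univ_lt_top_of_isCompact_of_ball_lt_top hK hKc one_pos
    fun x => (hfrost x 1 one_pos).trans_lt ENNReal.ofReal_lt_top⟩
  have : IsFiniteMeasure ((μH[(k : ℝ)]).restrict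
      (sphere (0 : EuclideanSpace ℝ (Fin (k + 1))) 1)) :=
    ⟨by rw [Measure.restrict_apply_univ]; exact hausdorffMeasure_sphere_lt_top k⟩
  obtain ⟨A, hA0, hA⟩ := (isRotationInvariant_hausdorffMeasure (k + 1) k
    ).exists_lintegral_maximal_sq_le hα0.le hα1 hfrost hr0 hR0.le hε
  have hq : 0 ≤ 1 / q - 1 / 2 := by
    rw [sub_nonneg]; exact one_div_le_one_div_of_le hq0 hq2.le
  refine ⟨(A + 1) ^ (1 / 2 : ℝ) * (lam.real Set.univ + 1) ^ (1 / q - 1 / 2), by positivity,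
    fun f => ?_⟩
  obtain ⟨H, hHm, hHle, hHint⟩ := hA (f.postcompCLM Complex.ofRealCLM)
  have hsup : ∀ x, ENNReal.ofReal (⨆ r : Set.Ioo r0 R0, |sphAvg (⇑f) x r|) ≤ H x := by
    intro x
    rcases eq_or_ne (H x) ⊤ with h | h
    · rw [h]; exact le_top
    rw [ENNReal.ofReal_le_iff_le_toReal h]
    refine Real.iSup_le (fun r => ?_) ENNReal.toReal_nonneg
    rw [← ENNReal.ofReal_le_iff_le_toReal h]
    refine le_trans (le_of_eq ?_) (hHle x r (Set.Ioo_subset_Icc_self r.2))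
    simp only [SchwartzMap.postcompCLM_apply, Complex.ofRealCLM_apply]
    rw [integral_complex_ofReal, ← ofReal_norm, Complex.norm_real, Real.norm_eq_abs, sphAvg, hdk]
  have hN : (A * ∫ ξ, (1 + ‖ξ‖ ^ 2) ^ ((1 - α) / 2 + ε) *
      ‖FourierTransform.fourier (⇑(f.postcompCLM Complex.ofRealCLM)) ξ‖ ^ 2) ^ (1 / 2 : ℝ) ≤
      (A + 1) ^ (1 / 2 : ℝ) * sobolevNorm ((1 - α) / 2 + ε) (⇑f) := by
    rw [Real.mul_rpow hA0 (integral_nonneg fun _ => by positivity)]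
    refine mul_le_mul (Real.rpow_le_rpow hA0 (by linarith) (by norm_num)) (le_of_eq rfl)
      (Real.rpow_nonneg (integral_nonneg fun _ => by positivity) _) (by positivity)
  calc (∫⁻ x, ENNReal.ofReal (⨆ r : Set.Ioo r0 R0, |sphAvg (⇑f) x r|) ^ q ∂lam) ^ (1 / q)
      ≤ (∫⁻ x, H x ^ q ∂lam) ^ (1 / q) := by
        refine ENNReal.rpow_le_rpow (lintegral_mono fun x => ?_) (by positivity)
        exact ENNReal.rpow_le_rpow (hsup x) hq0.le
    _ ≤ (∫⁻ x, H x ^ (2 : ℝ) ∂lam) ^ (1 / 2 : ℝ) * lam Set.univ ^ (1 / q - 1 / 2) := by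
        simpa only [eLpNorm', enorm_eq_self] using
          eLpNorm'_le_eLpNorm'_mul_rpow_measure_univ hq0 hq2.le hHm.aestronglyMeasurable
    _ ≤ ENNReal.ofReal ((A + 1) ^ (1 / 2 : ℝ) * sobolevNorm ((1 - α) / 2 + ε) (⇑f)) *
          ENNReal.ofReal ((lam.real Set.univ + 1) ^ (1 / q - 1 / 2)) := by
        refine mul_le_mul' ?_ ?_
        · simp only [ENNReal.rpow_two]
          refine (ENNReal.rpow_le_rpow hHint (by norm_num)).trans ?_
          rw [ENNReal.ofReal_rpow_of_nonneg (mul_nonneg hA0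
            (integral_nonneg fun _ => by positivity)) (by norm_num)]
          exact ENNReal.ofReal_le_ofReal hN
        · rw [← ENNReal.ofReal_rpow_of_nonneg (by positivity) hq]
          refine ENNReal.rpow_le_rpow ?_ hq
          rw [← ofReal_measureReal]
          exact ENNReal.ofReal_le_ofReal (by linarith)
    _ = _ := by
        rw [← ENNReal.ofReal_mul' (by positivity)]
        congr 1
        ring
end
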